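/- arXiv:math/9909018 — 2 statements merged into one kernel-verified Lean document; each statement's English description precedes it below -/
import Mathlib

section
/- Assume Hypothesis (A). Let 0 ≤ m < n, let ω be a homogeneous polynomial differential m-form over K[x_1,…,x_n] of coefficient degree l, and let ω' be a homogeneous m-form of coefficient degree l − δ + δ', and suppose that df^(δ)∧ω = 0 and df^(δ)∧ω' + df^(δ')∧ω = 0. Then there exist a homogeneous (m−1)-form ξ of coefficient degree l − δ + 1 and a homogeneous (m−1)-form ξ' of coefficient degree l − δ' + 1 such that ω = df^(δ)∧ξ + df^(δ')∧ξ' and df^(δ)∧ξ' = 0. (This expresses the vanishing E^{r,s}_{δ−δ'+1} = 0 for all r + s ≠ n of the spectral sequence attached to the degree filtration on the complex of polynomial differential forms with differential φ_f(ω) = df∧ω.) -/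
open MvPolynomial

noncomputable section

/-- A polynomial differential `m`-form over `K[x_1,…,x_n]`, recorded by its coefficients:
to each subset `T ⊆ {1,…,n}` of cardinality `m` (the index set `i_1 < ⋯ < i_m` of
`dx_{i_1} ∧ ⋯ ∧ dx_{i_m}`) we assign a polynomial coefficient. -/
abbrev MForm (K : Type*) [CommSemiring K] (n m : ℕ) : Type _ :=
  ∀ T : Finset (Fin n), T.card = m → MvPolynomial (Fin n) K

/-- The wedge product `dg ∧ ω` of the exterior derivative of `g` with an `m`-form `ω`:
its coefficient on `T = {i_0 < ⋯ < i_m}` is `∑ k, (-1)^k (∂g/∂x_{i_k}) ω(T \ {i_k})`. -/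
def wedgeD {K : Type*} [CommRing K] {n m : ℕ} (g : MvPolynomial (Fin n) K)
    (ω : MForm K n m) : MForm K n (m + 1) := fun T hT =>
  ∑ j ∈ T.attach,
    (-1 : MvPolynomial (Fin n) K) ^ (T.filter (fun i => i < j.1)).card *
      pderiv j.1 g * ω (T.erase j.1) (by rw [Finset.card_erase_of_mem j.2]; omega)

/-- `g` is homogeneous of (possibly negative) degree `d : ℤ`; by convention the only
homogeneous polynomial of negative degree is `0`. -/
def HomogZ {K : Type*} [CommSemiring K] {σ : Type*} (g : MvPolynomial σ K) (d : ℤ) : Prop :=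
  g = 0 ∨ ∃ d' : ℕ, (d' : ℤ) = d ∧ g.IsHomogeneous d'

/-- A list of ring elements is a regular sequence when each entry is a nonzerodivisor
modulo the ideal generated by the preceding entries. -/
def IsRegSeq {R : Type*} [CommRing R] (rs : List R) : Prop :=
  ∀ (i : ℕ) (hi : i < rs.length) (x : R),
    rs[i] * x ∈ Ideal.span {y | ∃ (j : ℕ) (hj : j < i), y = rs[j]'(hj.trans hi)} →
    x ∈ Ideal.span {y | ∃ (j : ℕ) (hj : j < i), y = rs[j]'(hj.trans hi)}

/-- The origin is an isolated critical point of (the polynomial map defined by) `h`: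
it is a common zero of all partial derivatives `∂h/∂x_i`, and there is a Zariski-open
neighborhood `U` of the origin (wlog a basic open set `u ≠ 0` with `u(0) ≠ 0`) on which
the origin is the only common zero of the `∂h/∂x_i`. -/
def IsIsolatedCriticalAtZero {K : Type*} [CommSemiring K] {σ : Type*}
    (h : MvPolynomial σ K) : Prop :=
  (∀ i, eval (0 : σ → K) (pderiv i h) = 0) ∧
  ∃ u : MvPolynomial σ K, eval (0 : σ → K) u ≠ 0 ∧
    ∀ y : σ → K, eval y u ≠ 0 → (∀ i, eval y (pderiv i h) = 0) → y = 0

/-- The dehomogenization of `F` in the affine chart `x_j = 1` of `ℙ^{n-1}`, centered at the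
point `a` (which should satisfy `a j = 1`): a polynomial in the `n-1` variables `i ≠ j`. -/
def chartPoly {K : Type*} [CommRing K] {n : ℕ} (F : MvPolynomial (Fin n) K) (j : Fin n)
    (a : Fin n → K) : MvPolynomial {i : Fin n // i ≠ j} K :=
  aeval (fun i : Fin n => if h : i = j then 1 else X ⟨i, h⟩ + C (a i)) F

/-- `g` is weighted homogeneous of total degree `d`: there are positive integer weights
`α_i` with gcd `1` such that every monomial of `g` has weighted degree `d`
(equivalently, `g(λ^{α_1}x_1,…) = λ^d g(x)`). -/
def IsWeightedHomogTD {K : Type*} [CommSemiring K] {σ : Type*} [Fintype σ]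
    (g : MvPolynomial σ K) (d : ℕ) : Prop :=
  ∃ α : σ → ℕ, (∀ i, 0 < α i) ∧ Finset.univ.gcd α = 1 ∧ IsWeightedHomogeneous α g d

/-- The hypersurface `h = 0` has a weighted homogeneous singularity at the origin, of total
degree `d`: the complete local ring `K[[x]]/(h)` is isomorphic as a `K`-algebra to
`K[[x]]/(g)` for some weighted homogeneous `g` of total degree `d`. -/
def WeightedHomogSing {K : Type*} [Field K] {σ : Type*} [Fintype σ]
    (h : MvPolynomial σ K) (d : ℕ) : Prop :=
  ∃ g : MvPolynomial σ K, IsWeightedHomogTD g d ∧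
    Nonempty ((MvPowerSeries σ K ⧸ Ideal.span {(h : MvPowerSeries σ K)}) ≃ₐ[K]
      MvPowerSeries σ K ⧸ Ideal.span {(g : MvPowerSeries σ K)})

/-- The common zero locus, in the projective space `ℙ^{n-1}`, of a set `S` of
(homogeneous) polynomials. -/
def projZeros {K : Type*} [Field K] {n : ℕ} (S : Set (MvPolynomial (Fin n) K)) :
    Set (Projectivization K (Fin n → K)) :=
  {x | ∃ (v : Fin n → K) (hv : v ≠ 0), Projectivization.mk K v hv = x ∧ ∀ g ∈ S, eval v g = 0}

/-- A homogeneous polynomial `G` in `m` variables defines a smooth hypersurface in `ℙ^{m-1}`: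
`G` and its partial derivatives have no common zero in `ℙ^{m-1}`. -/
def SmoothProj {K : Type*} [Field K] {σ : Type*} (G : MvPolynomial σ K) : Prop :=
  ∀ y : σ → K, y ≠ 0 → ¬ (eval y G = 0 ∧ ∀ i, eval y (pderiv i G) = 0)

/-- `F(x_1,…,x_{n-1},0)`, as a polynomial in the first `n-1` variables. -/
def truncAtLast {K : Type*} [CommRing K] {n : ℕ} (F : MvPolynomial (Fin n) K) :
    MvPolynomial (Fin (n - 1)) K :=
  aeval (fun i : Fin n => if h : (i : ℕ) < n - 1 then X (⟨i, h⟩ : Fin (n - 1)) else 0) F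

/-- `F(y_1,…,y_{n-1},1)`, as a polynomial in the first `n-1` variables. -/
def dehomAtLast {K : Type*} [CommRing K] {n : ℕ} (F : MvPolynomial (Fin n) K) :
    MvPolynomial (Fin (n - 1)) K :=
  aeval (fun i : Fin n => if h : (i : ℕ) < n - 1 then X (⟨i, h⟩ : Fin (n - 1)) else 1) F

/-- The point `(b, 1) ∈ K^n` lying over `b ∈ K^{n-1}` (affine chart `x_n = 1`). -/
def liftPt {K : Type*} [CommRing K] {n : ℕ} (b : Fin (n - 1) → K) : Fin n → K :=
  fun i => if h : (i : ℕ) < n - 1 then b ⟨i, h⟩ else 1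

/-- Context of the paper: `f` has degree `δ ≥ 2`, `1 ≤ δ' ≤ δ - 1`, and
`f = f^(δ) + f^(δ') + (terms of degree < δ')`, with `f^(δ')` the (nonzero) homogeneous
component of second-highest degree. -/
def Setup {K : Type*} [Field K] {n : ℕ} (δ δ' : ℕ) (f : MvPolynomial (Fin n) K) : Prop :=
  f.totalDegree = δ ∧ 2 ≤ δ ∧ 1 ≤ δ' ∧ δ' < δ ∧
  (∀ j, δ' < j → j < δ → homogeneousComponent j f = 0) ∧
  homogeneousComponent δ' f ≠ 0

/-- Hypothesis (A): `p ∤ δ`, `p ∤ δ'`; every singular point of the hypersurface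
`f^(δ) = 0` in `ℙ^{n-1}` (taken with a representative normalized by `a j = 1`) is an
isolated singularity, weighted homogeneous of some total degree `d` with `p ∤ d`,
and does not lie on the hypersurface `f^(δ') = 0`. -/
def HypA {K : Type*} [Field K] {n : ℕ} (p δ δ' : ℕ) (f : MvPolynomial (Fin n) K) : Prop :=
  ¬ (p ∣ δ) ∧ ¬ (p ∣ δ') ∧
  ∀ (a : Fin n → K) (j : Fin n), a j = 1 →
    eval a (homogeneousComponent δ f) = 0 →
    (∀ i, eval a (pderiv i (homogeneousComponent δ f)) = 0) →
    IsIsolatedCriticalAtZero (chartPoly (homogeneousComponent δ f) j a) ∧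
    (∃ d : ℕ, ¬ (p ∣ d) ∧ WeightedHomogSing (chartPoly (homogeneousComponent δ f) j a) d) ∧
    eval a (homogeneousComponent δ' f) ≠ 0

/-- Hypothesis (B): `p ∣ δ`, `p ∤ δ'`, the common zero locus of the `∂f^(δ)/∂x_i` in
`ℙ^{n-1}` is finite and nonempty, and none of its points lies on the hypersurface
`f^(δ') = 0`. -/
def HypB {K : Type*} [Field K] {n : ℕ} (p δ δ' : ℕ) (f : MvPolynomial (Fin n) K) : Prop :=
  (p ∣ δ) ∧ ¬ (p ∣ δ') ∧
  (projZeros {g | ∃ i, g = pderiv i (homogeneousComponent δ f)}).Finite ∧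
  (projZeros {g | ∃ i, g = pderiv i (homogeneousComponent δ f)}).Nonempty ∧
  ∀ a : Fin n → K, a ≠ 0 → (∀ i, eval a (pderiv i (homogeneousComponent δ f)) = 0) →
    eval a (homogeneousComponent δ' f) ≠ 0

/-- The localization of the polynomial ring at the maximal ideal of the point `b`. -/
instance evalKerPrime (K : Type*) [Field K] (σ : Type*) (b : σ → K) :
    (RingHom.ker (eval b : MvPolynomial σ K →+* K)).IsPrime := RingHom.ker_isPrime _

/-- The local ring of affine space at the point `b`, i.e. the localization of the
polynomial ring at the maximal ideal of polynomials vanishing at `b`. -/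
abbrev LocAt (K : Type*) [Field K] {σ : Type*} (b : σ → K) :=
  Localization.AtPrime (RingHom.ker (eval b : MvPolynomial σ K →+* K))

/-- The Milnor number of `h` at the point `b`: the `K`-dimension of the quotient of the
local ring at `b` by the ideal generated by the partial derivatives of `h`. -/
def milnorAt {K : Type*} [Field K] {σ : Type*} (b : σ → K) (h : MvPolynomial σ K) : ℕ :=
  Module.finrank K
    ((LocAt K b) ⧸ Ideal.span (Set.range fun i =>
      algebraMap (MvPolynomial σ K) (LocAt K b) (pderiv i h)))


section Ext
variable {R : Type*} [CommRing R] {n : ℕ}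

/-- sign -/
def sg (R : Type*) [CommRing R] {n : ℕ} (j : Fin n) (T : Finset (Fin n)) : R :=
  (-1) ^ (T.filter (fun i => i < j)).card

/-- wedge with `dx_j` -/
def ee (R : Type*) [CommRing R] {n : ℕ} (j : Fin n) : Module.End R (Finset (Fin n) → R) where
  toFun ω T := if j ∈ T then sg R j T * ω (T.erase j) else 0
  map_add' x y := by ext T; by_cases h : j ∈ T <;> simp [h, mul_add]
  map_smul' c x := by ext T; by_cases h : j ∈ T <;> simp [h]; ring

/-- contraction with `∂_j` -/
def ii (R : Type*) [CommRing R] {n : ℕ} (j : Fin n) : Module.End R (Finset (Fin n) → R) where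
  toFun ω T := if j ∈ T then 0 else sg R j T * ω (insert j T)
  map_add' x y := by ext T; by_cases h : j ∈ T <;> simp [h, mul_add]
  map_smul' c x := by ext T; by_cases h : j ∈ T <;> simp [h]; ring

lemma ee_apply (j : Fin n) (ω : Finset (Fin n) → R) (T) :
  ee R j ω T = if j ∈ T then sg R j T * ω (T.erase j) else 0 := rfl
lemma ii_apply (j : Fin n) (ω : Finset (Fin n) → R) (T) :
  ii R j ω T = if j ∈ T then 0 else sg R j T * ω (insert j T) := rfl

lemma sg_mul_self (j : Fin n) (T) : sg R j T * sg R j T = 1 := by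
  unfold sg; rw [← mul_pow]; simp

lemma sg_erase_self (j : Fin n) (T) : sg R j (T.erase j) = sg R j T := by
  unfold sg; congr 2; ext i; simp; intro h _; exact h.ne
lemma sg_insert_self (j : Fin n) (T) : sg R j (insert j T) = sg R j T := by
  unfold sg; congr 2; ext i; simp; grind
lemma sg_insert_lt {j k : Fin n} (T) (h : k < j) (hk : k ∉ T) :
    sg R j (insert k T) = - sg R j T := by
  unfold sg
  rw [Finset.filter_insert, if_pos h, Finset.card_insert_of_notMem (by simp [hk]), pow_succ]; ring
lemma sg_insert_gt {j k : Fin n} (T) (h : j < k)  :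
    sg R j (insert k T) = sg R j T := by
  unfold sg
  rw [Finset.filter_insert, if_neg h.not_gt]
lemma sg_erase_lt {j k : Fin n} (T) (h : k < j) (hk : k ∈ T) :
    sg R j (T.erase k) = - sg R j T := by
  have := sg_insert_lt (R := R) (T.erase k) h (by simp)
  rw [Finset.insert_erase hk] at this; rw [this]; ring
lemma sg_erase_gt {j k : Fin n} (T) (h : j < k) :
    sg R j (T.erase k) = sg R j T := by
  unfold sg
  congr 2; ext i; simp; intro h1 _; exact (h1.trans h).ne

lemma ee_sq (j : Fin n) : ee R j * ee R j = 0 := by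

  apply LinearMap.ext; intro ω; ext T; simp [ee_apply]

lemma ee_anti {j k : Fin n} (hjk : j ≠ k) : ee R j * ee R k + ee R k * ee R j = 0 := by
  apply LinearMap.ext; intro ω; ext T
  wlog h : j < k generalizing j k
  · rw [add_comm]; exact this hjk.symm (lt_of_le_of_ne (not_lt.mp h) hjk.symm)
  simp only [LinearMap.add_apply, Module.End.mul_apply, Pi.add_apply, ee_apply, LinearMap.zero_apply, Pi.zero_apply]
  by_cases hj : j ∈ T <;> by_cases hk : k ∈ T <;> simp [hj, hk, hjk, hjk.symm]
  rw [sg_erase_lt T h hj, sg_erase_gt T h, Finset.erase_right_comm]; ring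

lemma ee_ii_self (j : Fin n) : ee R j * ii R j + ii R j * ee R j = 1 := by
  apply LinearMap.ext; intro ω; ext T
  simp only [LinearMap.add_apply, Module.End.mul_apply, Pi.add_apply, ee_apply, ii_apply, Module.End.one_apply]
  by_cases hj : j ∈ T <;> simp [hj]
  · rw [sg_erase_self, ← mul_assoc, sg_mul_self, one_mul]
  · rw [sg_insert_self, ← mul_assoc, sg_mul_self, one_mul]

lemma ee_ii_ne {j k : Fin n} (hjk : j ≠ k) : ee R j * ii R k + ii R k * ee R j = 0 := by
  apply LinearMap.ext; intro ω; ext T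
  simp only [LinearMap.add_apply, Module.End.mul_apply, Pi.add_apply, ee_apply, ii_apply, LinearMap.zero_apply, Pi.zero_apply]
  by_cases hj : j ∈ T <;> by_cases hk : k ∈ T <;> simp [hj, hk, hjk, hjk.symm]
  rw [Finset.erase_insert_of_ne hjk.symm]
  rcases lt_or_gt_of_ne hjk with h | h
  · rw [sg_erase_lt T h hj, sg_insert_gt T h]; ring
  · rw [sg_erase_gt T h, sg_insert_lt T h hk]; ring

/-- wedge with a covector -/
def wd (c : Fin n → R) : Module.End R (Finset (Fin n) → R) := ∑ j, c j • ee R j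
/-- contraction with a vector -/
def ct (c : Fin n → R) : Module.End R (Finset (Fin n) → R) := ∑ j, c j • ii R j

lemma wd_sq (c : Fin n → R) : wd c * wd c = 0 := by
  unfold wd
  induction (Finset.univ : Finset (Fin n)) using Finset.induction_on with
  | empty => simp
  | insert a s ha ih =>
    rw [Finset.sum_insert ha, add_mul, mul_add, mul_add, ih]
    have : (c a • ee R a) * (∑ j ∈ s, c j • ee R j) + (∑ j ∈ s, c j • ee R j) * (c a • ee R a) = 0 := by
      rw [Finset.mul_sum, Finset.sum_mul, ← Finset.sum_add_distrib]
      apply Finset.sum_eq_zero; intro j hj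
      have h : a ≠ j := by rintro rfl; exact ha hj
      rw [smul_mul_smul_comm, smul_mul_smul_comm, mul_comm (c j), ← smul_add, ee_anti h, smul_zero]
    rw [add_zero, add_assoc, this, smul_mul_smul_comm, ee_sq]; simp

lemma wd_anti (c c' : Fin n → R) : wd c * wd c' + wd c' * wd c = 0 := by
  have h := wd_sq (c + c')
  have h3 : wd (c + c') = wd c + wd c' := by simp [wd, add_smul, Finset.sum_add_distrib]
  rw [h3, add_mul, mul_add, mul_add, wd_sq, wd_sq] at h
  simpa using h

lemma wd_ct (c l : Fin n → R) : wd c * ct l + ct l * wd c = (∑ j, l j * c j) • 1 := by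
  unfold wd ct
  rw [Finset.sum_mul_sum, Finset.sum_mul_sum, Finset.sum_comm, ← Finset.sum_add_distrib, Finset.sum_smul]
  refine Finset.sum_congr rfl fun k _ => ?_
  rw [← Finset.sum_add_distrib, Finset.sum_eq_single k]
  · rw [smul_mul_smul_comm, smul_mul_smul_comm, mul_comm (c k), ← smul_add, ee_ii_self]
  · intro j _ hj
    rw [smul_mul_smul_comm, smul_mul_smul_comm, mul_comm (c j), ← smul_add, ee_ii_ne hj, smul_zero]
  · simp

lemma wd_wd_apply (c : Fin n → R) (ω) : wd c (wd c ω) = 0 := by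
  rw [← Module.End.mul_apply, wd_sq]; rfl
lemma wd_anti_apply (c c' : Fin n → R) (ω) : wd c (wd c' ω) = - wd c' (wd c ω) := by
  have := congrArg (fun f => f ω) (wd_anti c c')
  exact eq_neg_of_add_eq_zero_left this
lemma wd_ct_apply (c l : Fin n → R) (ω) : wd c (ct l ω) + ct l (wd c ω) = (∑ j, l j * c j) • ω := by
  exact congrArg (fun f => f ω) (wd_ct c l)

lemma wd_apply (c : Fin n → R) (ω T) : wd c ω T = ∑ j ∈ T, c j * (sg R j T * ω (T.erase j)) := by
  simp [wd, LinearMap.sum_apply, Finset.sum_apply, ee_apply]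

lemma ct_apply (c : Fin n → R) (ω T) : ct c ω T = ∑ j ∈ Tᶜ, c j * (sg R j T * ω (insert j T)) := by
  simp [ct, LinearMap.sum_apply, Finset.sum_apply, ii_apply]
  rw [← Finset.sum_filter_add_sum_filter_not Finset.univ (fun j => j ∈ T)]
  rw [Finset.sum_eq_zero, zero_add]
  · rw [show Tᶜ = Finset.univ.filter (fun j => j ∉ T) by ext; simp]
    refine Finset.sum_congr rfl fun k hk => ?_
    simp at hk; simp [hk]
  · intro x hx; simp at hx; simp [hx]

/-- coefficientwise membership in an ideal is preserved by linear maps -/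
lemma pres {X : Type*} [Finite X] (f : Module.End R (X → R)) (Q : Ideal R) (c : X → R)
    (h : ∀ x, c x ∈ Q) (y) : f c y ∈ Q := by
  classical
  have := Fintype.ofFinite X
  rw [LinearMap.pi_apply_eq_sum_univ f c, Finset.sum_apply]
  refine Ideal.sum_mem _ fun i _ => ?_
  exact Ideal.mul_mem_right _ _ (h i)

end Ext

/-- Abstract acyclicity lemma. -/
lemma acyc {R C : Type*} [CommRing R] [AddCommGroup C] [Module R C] (D : Module.End R C)
    (hD : ∀ c, D (D c) = 0) (n : ℕ) (N : ℕ → Submodule R C) (fil : ℕ → C → Prop)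
    (h0 : ∀ c, fil 0 c → c = 0)
    (hDN : ∀ k c, c ∈ N k → D c ∈ N k)
    (hs : ∀ k < n, ∃ (a : R) (s : Module.End R C), (∀ c, D (s c) + s (D c) = a • c) ∧
      (∀ c, c ∈ N k → s c ∈ N k) ∧ (∀ i c, fil (i + 1) c → fil i (s c)) ∧
      (∀ c, a • c ∈ N k → c ∈ N k) ∧ (∀ c ∈ N k, c ∈ N (k + 1)) ∧ (∀ c, a • c ∈ N (k + 1)) ∧
      (∀ c ∈ N (k + 1), ∃ c1 c2, c2 ∈ N k ∧ c = a • c1 + c2)) :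
    ∀ i k c, i + k = n → fil i c → D c ∈ N k → ∃ η, c - D η ∈ N k := by
  intro i
  induction i with
  | zero => intro k c _ hc _; rw [h0 c hc]; exact ⟨0, by simp⟩
  | succ i ih =>
    intro k c hik hc hDc
    obtain ⟨a, s, hh, hsN, hsf, hreg, hmono, haN, hdec⟩ := hs k (by omega)
    have h1 : D (s c) ∈ N (k + 1) := by
      rw [eq_sub_of_add_eq (hh c)]
      exact Submodule.sub_mem _ (haN c) (hmono _ (hsN _ hDc))
    obtain ⟨η, hη⟩ := ih (k + 1) (s c) (by omega) (hsf _ _ hc) h1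
    obtain ⟨c1, c2, hc2, he⟩ := hdec _ hη
    refine ⟨c1, hreg _ ?_⟩
    have h2 : s c = D η + a • c1 + c2 := by rw [add_assoc, ← he]; abel
    have h3 := hh c
    rw [h2, map_add, map_add, hD, map_smul] at h3
    have : a • (c - D c1) = D c2 + s (D c) := by rw [smul_sub, ← h3]; abel
    rw [this]
    exact Submodule.add_mem _ (hDN _ _ hc2) (hsN _ hDc)



section Reg
variable {K : Type*} [Field K] {n : ℕ}

/-- ideal generated by the `N`-th powers of the first `k` variables -/
def QQ (K : Type*) [Field K] (n N k : ℕ) : Ideal (MvPolynomial (Fin n) K) :=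
  Ideal.span ((fun s => monomial s (1 : K)) '' {s | ∃ i : Fin n, (i : ℕ) < k ∧ s = Finsupp.single i N})

lemma QQ_zero (N : ℕ) : QQ K n N 0 = ⊥ := by simp [QQ]

lemma QQ_succ (N k : ℕ) (hk : k < n) : QQ K n N (k + 1) =
    Ideal.span {X ⟨k, hk⟩ ^ N} ⊔ QQ K n N k := by
  unfold QQ
  rw [← Ideal.span_union]
  congr 1
  rw [X_pow_eq_monomial, ← Set.image_singleton (f := fun s => monomial s (1 : K)), ← Set.image_union]
  congr 1
  ext s
  simp only [Set.mem_ofPred_eq, Set.singleton_union, Set.mem_insert_iff]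
  constructor
  · rintro ⟨i, hi, rfl⟩
    rcases Nat.lt_succ_iff_lt_or_eq.mp hi with h | h
    · exact Or.inr ⟨i, h, rfl⟩
    · left; congr 1; exact Fin.ext h
  · rintro (h | ⟨i, hi, rfl⟩)
    · exact ⟨⟨k, hk⟩, by simp, h⟩
    · exact ⟨i, by omega, rfl⟩

lemma QQ_reg (N k : ℕ) (hk : k < n) (x : MvPolynomial (Fin n) K)
    (h : X ⟨k, hk⟩ ^ N * x ∈ QQ K n N k) : x ∈ QQ K n N k := by
  unfold QQ at *
  rw [mem_ideal_span_monomial_image] at *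
  intro e he
  obtain ⟨s, ⟨i, hi, rfl⟩, hs⟩ := h (Finsupp.single ⟨k, hk⟩ N + e) (by
    rw [mem_support_iff, X_pow_eq_monomial, coeff_monomial_mul, one_mul]
    exact mem_support_iff.mp he)
  refine ⟨_, ⟨i, hi, rfl⟩, ?_⟩
  rw [Finsupp.single_le_iff] at *
  rw [Finsupp.add_apply, Finsupp.single_eq_of_ne, zero_add] at hs
  · exact hs
  · intro h; subst h; simp at hi

/-- forms with coefficients -/
lemma cone_acyc (c : Fin n → MvPolynomial (Fin n) K) (g : MvPolynomial (Fin n) K) (N : ℕ)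
    (hN : ∀ i, ∃ (l : Fin n → MvPolynomial (Fin n) K) (μ : MvPolynomial (Fin n) K),
      (X i : MvPolynomial (Fin n) K) ^ N = ∑ j, l j * c j + μ * g)
    (ω ω' : Finset (Fin n) → MvPolynomial (Fin n) K)
    (hω : ∀ T, n ≤ T.card → ω T = 0) (hω' : ∀ T, n ≤ T.card + 1 → ω' T = 0)
    (h1 : wd c ω = 0) (h2 : g • ω = wd c ω') :
    ∃ η η', ω = wd c η ∧ ω' = g • η - wd c η' := by
  let V := Finset (Fin n) → MvPolynomial (Fin n) K
  let D : Module.End (MvPolynomial (Fin n) K) (V × V) :=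
    LinearMap.prod ((wd c) ∘ₗ LinearMap.fst _ _ _)
      (g • LinearMap.fst _ _ _ - (wd c) ∘ₗ LinearMap.snd _ _ _)
  have hDa : ∀ a : V × V, D a = (wd c a.1, g • a.1 - wd c a.2) := fun a => rfl
  let NN : ℕ → Submodule (MvPolynomial (Fin n) K) (V × V) := fun k =>
    { carrier := {a | ∀ T, a.1 T ∈ QQ K n N k ∧ a.2 T ∈ QQ K n N k}
      add_mem' := fun {a b} ha hb T =>
        ⟨Ideal.add_mem _ (ha T).1 (hb T).1, Ideal.add_mem _ (ha T).2 (hb T).2⟩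
      zero_mem' := fun T => ⟨Ideal.zero_mem _, Ideal.zero_mem _⟩
      smul_mem' := fun r a ha T =>
        ⟨Ideal.mul_mem_left _ _ (ha T).1, Ideal.mul_mem_left _ _ (ha T).2⟩ }
  have hNN : ∀ k (a : V × V), a ∈ NN k ↔ ∀ T, a.1 T ∈ QQ K n N k ∧ a.2 T ∈ QQ K n N k :=
    fun k a => Iff.rfl
  have key := acyc D (by
      intro a
      rw [hDa, hDa]
      simp only [wd_wd_apply, map_sub, map_smul, sub_zero, sub_self]; rfl) n NN
    (fun i a => (∀ T, i ≤ T.card → a.1 T = 0) ∧ (∀ T, i ≤ T.card + 1 → a.2 T = 0))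
    (by
      intro a ha
      refine Prod.ext (funext fun T => ha.1 T (Nat.zero_le _)) (funext fun T => ha.2 T (Nat.zero_le _)))
    (by
      intro k a ha
      rw [hNN] at *
      intro T
      rw [hDa]
      exact ⟨pres _ _ _ (fun T => (ha T).1) T, Ideal.sub_mem _ (Ideal.mul_mem_left _ _ (ha T).1)
        (pres _ _ _ (fun T => (ha T).2) T)⟩)
    (by
      intro k hk
      obtain ⟨l, μ, hl⟩ := hN ⟨k, hk⟩
      let s : Module.End (MvPolynomial (Fin n) K) (V × V) :=
        LinearMap.prod ((ct l) ∘ₗ LinearMap.fst _ _ _ + μ • LinearMap.snd _ _ _)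
        (- (ct l) ∘ₗ LinearMap.snd _ _ _)
      have hsa : ∀ a : V × V, s a = (ct l a.1 + μ • a.2, - ct l a.2) := fun a => rfl
      refine ⟨X ⟨k, hk⟩ ^ N, s, ?_, ?_, ?_, ?_, ?_, ?_, ?_⟩
      · intro a
        rw [hsa, hDa, hDa, hsa]
        have e1 := wd_ct_apply c l a.1
        have e2 := wd_ct_apply c l a.2
        refine Prod.ext ?_ ?_
        · simp only [Prod.fst_add, Prod.smul_fst, map_add, map_smul, hl, add_smul, ← e1, smul_sub,
            smul_smul]
          abel
        · simp only [Prod.snd_add, Prod.smul_snd, map_add, map_smul, hl, add_smul, ← e2, smul_add,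
            smul_smul, map_neg, map_sub, mul_comm μ g]
          abel
      · intro a ha
        rw [hNN] at *
        intro T
        rw [hsa]
        exact ⟨Ideal.add_mem _ (pres _ _ _ (fun T => (ha T).1) T) (Ideal.mul_mem_left _ _ (ha T).2),
          (Ideal.neg_mem_iff _).mpr (pres _ _ _ (fun T => (ha T).2) T)⟩
      · rintro i a ⟨ha1, ha2⟩
        rw [hsa]
        have aux : ∀ (b : V) (m : ℕ), (∀ T, m + 1 ≤ T.card → b T = 0) → ∀ T, m ≤ T.card →
            ct l b T = 0 := by
          intro b m hb T hT
          rw [ct_apply]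
          refine Finset.sum_eq_zero fun j hj => ?_
          rw [hb, mul_zero, mul_zero]
          rw [Finset.card_insert_of_notMem (by simpa using hj)]; omega
        constructor
        · intro T hT
          change ct l a.1 T + μ * a.2 T = 0
          rw [aux a.1 i ha1 T hT, ha2 T (by omega)]; simp
        · intro T hT
          simp only [Pi.neg_apply, neg_eq_zero]
          rw [ct_apply]
          refine Finset.sum_eq_zero fun j hj => ?_
          rw [ha2, mul_zero, mul_zero]
          rw [Finset.card_insert_of_notMem (by simpa using hj)]; omega
      · intro a ha
        rw [hNN] at *
        exact fun T => ⟨QQ_reg _ _ hk _ (ha T).1, QQ_reg _ _ hk _ (ha T).2⟩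
      · intro a ha
        rw [hNN] at *
        have : QQ K n N k ≤ QQ K n N (k + 1) := by rw [QQ_succ _ _ hk]; exact le_sup_right
        exact fun T => ⟨this (ha T).1, this (ha T).2⟩
      · intro a
        rw [hNN]
        have : X ⟨k, hk⟩ ^ N ∈ QQ K n N (k + 1) := by
          rw [QQ_succ _ _ hk]; exact Ideal.mem_sup_left (Ideal.mem_span_singleton_self _)
        exact fun T => ⟨Ideal.mul_mem_right _ _ this, Ideal.mul_mem_right _ _ this⟩
      · intro a ha
        rw [hNN] at ha
        simp only [QQ_succ _ _ hk, Ideal.mem_span_singleton_sup] at ha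
        choose h1 h2 using ha
        choose p1 q1 hq1 e1 using h1
        choose p2 q2 hq2 e2 using h2
        refine ⟨(p1, p2), (q1, q2), ?_, ?_⟩
        · rw [hNN]; exact fun T => ⟨hq1 T, hq2 T⟩
        · refine Prod.ext (funext fun T => ?_) (funext fun T => ?_)
          · rw [← e1 T, mul_comm]; rfl
          · rw [← e2 T, mul_comm]; rfl)
    n 0 (ω, ω') rfl ⟨hω, hω'⟩ (by
      rw [hDa]; simp only [h1, h2, sub_self]; exact Submodule.zero_mem _)
  obtain ⟨η, hη⟩ := key
  have : (ω, ω') - D η = 0 := by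
    rw [hNN, QQ_zero] at hη
    exact Prod.ext (funext fun T => (hη T).1) (funext fun T => (hη T).2)
  rw [sub_eq_zero, hDa] at this
  exact ⟨η.1, η.2, congrArg Prod.fst this, congrArg Prod.snd this⟩

end Reg


section Graded
variable {K : Type*} [Field K] {n : ℕ}

/-- homogeneous component of degree `l - s` (zero if negative) -/
def hcs (s l : ℕ) (q : MvPolynomial (Fin n) K) : MvPolynomial (Fin n) K :=
  if s ≤ l then homogeneousComponent (l - s) q else 0

lemma hcs_zero_right (s l : ℕ) : hcs s l (0 : MvPolynomial (Fin n) K) = 0 := by simp [hcs]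

lemma hcs_add (s l : ℕ) (p q : MvPolynomial (Fin n) K) : hcs s l (p + q) = hcs s l p + hcs s l q := by
  unfold hcs; split_ifs <;> simp

lemma hcs_sub (s l : ℕ) (p q : MvPolynomial (Fin n) K) : hcs s l (p - q) = hcs s l p - hcs s l q := by
  unfold hcs; split_ifs <;> simp

lemma hcs_sum {ι : Type*} (S : Finset ι) (s l : ℕ) (p : ι → MvPolynomial (Fin n) K) :
    hcs s l (∑ i ∈ S, p i) = ∑ i ∈ S, hcs s l (p i) := by
  unfold hcs; split_ifs <;> simp

lemma hcs_shift (s l e : ℕ) (q : MvPolynomial (Fin n) K) : hcs (s + e) (l + e) q = hcs s l q := by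
  unfold hcs; rw [Nat.add_sub_add_right]; simp

lemma hcs_self {l : ℕ} {q : MvPolynomial (Fin n) K} (h : q.IsHomogeneous l) : hcs 0 l q = q := by
  simp [hcs, homogeneousComponent_eq_self h]

lemma hcs_mul {c : MvPolynomial (Fin n) K} {e : ℕ} (hc : c.IsHomogeneous e) (s l : ℕ)
    (q : MvPolynomial (Fin n) K) : hcs s l (c * q) = c * hcs (s + e) l q := by
  conv_lhs => rw [← sum_homogeneousComponent q]
  conv_rhs => rw [← sum_homogeneousComponent q]
  rw [Finset.mul_sum, hcs_sum, hcs_sum, Finset.mul_sum]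
  refine Finset.sum_congr rfl fun i _ => ?_
  have h1 : (c * homogeneousComponent i q).IsHomogeneous (e + i) :=
    hc.mul (homogeneousComponent_isHomogeneous i q)
  unfold hcs
  split_ifs with h2 h3 h3
  · rw [homogeneousComponent_of_mem h1, homogeneousComponent_of_mem
      (homogeneousComponent_isHomogeneous i q)]
    by_cases h : l - s = e + i
    · rw [if_pos h, if_pos (by omega)]
    · rw [if_neg h, if_neg (by omega), mul_zero]
  · rw [homogeneousComponent_of_mem h1, if_neg (by omega), mul_zero]
  · omega
  · rw [mul_zero]

/-- truncation of forms to form degree `< k` and coefficient degree `l - s` -/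
def tr (k s l : ℕ) (ω : Finset (Fin n) → MvPolynomial (Fin n) K) :
    Finset (Fin n) → MvPolynomial (Fin n) K := fun T => if T.card < k then hcs s l (ω T) else 0

lemma wd_tr {c : Fin n → MvPolynomial (Fin n) K} {e : ℕ} (hc : ∀ j, (c j).IsHomogeneous e)
    (k s l : ℕ) (ω : Finset (Fin n) → MvPolynomial (Fin n) K) :
    wd c (tr k (s + e) l ω) = tr (k + 1) s l (wd c ω) := by
  funext T
  unfold tr
  rw [wd_apply]
  have h1 : ∀ j ∈ T, (T.erase j).card < k ↔ T.card < k + 1 := by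
    intro j hj
    rw [Finset.card_erase_of_mem hj]
    have := Finset.card_pos.mpr ⟨j, hj⟩
    omega
  split_ifs with h
  · rw [wd_apply, hcs_sum]
    refine Finset.sum_congr rfl fun j hj => ?_
    rw [hcs_mul (hc j), if_pos ((h1 j hj).mpr h)]
    congr 1
    unfold sg
    rcases neg_one_pow_eq_or (MvPolynomial (Fin n) K) (T.filter (fun i => i < j)).card with h2 | h2
    · rw [h2, one_mul, one_mul]
    · rw [h2, neg_one_mul, neg_one_mul, ← zero_sub (ω _), hcs_sub, hcs_zero_right, zero_sub]
  · refine Finset.sum_eq_zero fun j hj => ?_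
    rw [if_neg (by rw [h1 j hj]; exact h), mul_zero, mul_zero]

lemma tr_sub (k s l : ℕ) (ω ω' : Finset (Fin n) → MvPolynomial (Fin n) K) :
    tr k s l (ω - ω') = tr k s l ω - tr k s l ω' := by
  funext T; simp only [tr, Pi.sub_apply]; split_ifs <;> simp [hcs_sub]

lemma tr_smul {g : MvPolynomial (Fin n) K} {d : ℕ} (hg : g.IsHomogeneous d) (k s l : ℕ)
    (ω : Finset (Fin n) → MvPolynomial (Fin n) K) :
    tr k s l (g • ω) = g • tr k (s + d) l ω := by
  funext T; simp only [tr, Pi.smul_apply, smul_eq_mul]; split_ifs <;> simp [hcs_mul hg]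

lemma tr_zero (k s l : ℕ) : tr k s l (0 : Finset (Fin n) → MvPolynomial (Fin n) K) = 0 := by
  funext T; simp [tr, hcs_zero_right]

lemma acyc_homog (c : Fin n → MvPolynomial (Fin n) K) (g : MvPolynomial (Fin n) K) (N : ℕ)
    (hN : ∀ i, ∃ (l : Fin n → MvPolynomial (Fin n) K) (μ : MvPolynomial (Fin n) K),
      (X i : MvPolynomial (Fin n) K) ^ N = ∑ j, l j * c j + μ * g)
    {e d : ℕ} (hc : ∀ j, (c j).IsHomogeneous e) (hg : g.IsHomogeneous d) (hd : 1 ≤ d) (hn : 2 ≤ n) :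
    ∀ (l : ℕ) (ω : Finset (Fin n) → MvPolynomial (Fin n) K),
    (∀ T, (ω T).IsHomogeneous l) → (∀ T, n ≤ T.card + 1 → ω T = 0) → wd c ω = 0 →
    ∃ ζ, ω = wd c ζ := by
  intro l
  induction l using Nat.strong_induction_on with
  | _ l ih =>
    intro ω hω hs h0
    obtain ⟨η, η', h1, h2⟩ := cone_acyc c g N hN 0 ω (fun _ _ => rfl) hs (by simp) (by simp [h0])
    obtain ⟨k, rfl⟩ : ∃ k, n = k + 2 := ⟨n - 2, by omega⟩
    have h3 : ω = tr (k + 1) 0 l ω := by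
      funext T
      unfold tr
      split_ifs with h
      · rw [hcs_self (hω T)]
      · exact hs T (by omega)
    have h4 : ω = g • tr (k + 1) d l η - wd c (tr k e l η') := by
      have h5 := wd_tr hc k 0 l η'
      have h6 := tr_smul hg (k + 1) 0 l η
      rw [zero_add] at h5 h6
      rw [h5, ← h6, ← tr_sub, ← h2, ← h3]
    by_cases hdl : d ≤ l
    · obtain ⟨ζ, hζ⟩ := ih (l - d) (by omega) (tr (k + 1) d l η) (by
          intro T; unfold tr hcs
          rw [if_pos hdl]
          split_ifs
          · exact homogeneousComponent_isHomogeneous _ _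
          · exact isHomogeneous_zero _ _ _) (by
          intro T hT; unfold tr; rw [if_neg (by omega)]) (by
          have : tr (k + 1) d l η = tr (k + 1) (d + e) (l + e) η := by
            funext T; simp only [tr, hcs_shift]
          rw [this, wd_tr hc, ← h1, tr_zero])
      refine ⟨g • ζ - tr k e l η', ?_⟩
      rw [map_sub, map_smul, ← hζ, ← h4]
    · refine ⟨- tr k e l η', ?_⟩
      have : tr (k + 1) d l η = 0 := by
        funext T; simp [tr, hcs, hdl]
      rw [this, smul_zero, zero_sub] at h4
      rw [map_neg, ← h4]

lemma acyc_all (c : Fin n → MvPolynomial (Fin n) K) (g : MvPolynomial (Fin n) K) (N : ℕ)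
    (hN : ∀ i, ∃ (l : Fin n → MvPolynomial (Fin n) K) (μ : MvPolynomial (Fin n) K),
      (X i : MvPolynomial (Fin n) K) ^ N = ∑ j, l j * c j + μ * g)
    {e d : ℕ} (hc : ∀ j, (c j).IsHomogeneous e) (hg : g.IsHomogeneous d) (hd : 1 ≤ d) (hn : 2 ≤ n)
    (ω : Finset (Fin n) → MvPolynomial (Fin n) K)
    (hs : ∀ T, n ≤ T.card + 1 → ω T = 0) (h0 : wd c ω = 0) :
    ∃ ζ, ω = wd c ζ := by
  have h1 : ∀ l, ∃ ζ, tr n 0 l ω = wd c ζ := by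
    intro l
    refine acyc_homog c g N hN hc hg hd hn l _ ?_ ?_ ?_
    · intro T; unfold tr hcs
      split_ifs
      · exact homogeneousComponent_isHomogeneous _ _
      · omega
      · exact isHomogeneous_zero _ _ _
    · intro T hT; unfold tr; rw [hs T hT]; simp [hcs_zero_right]
    · have : tr n 0 l ω = tr n (0 + e) (l + e) ω := by
        funext T; simp only [tr, hcs_shift]
      rw [this, wd_tr hc, h0, tr_zero]
  choose ζ hζ using h1
  let L := Finset.univ.sup (fun T => (ω T).totalDegree) + 1
  refine ⟨∑ l ∈ Finset.range L, ζ l, ?_⟩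
  rw [map_sum]
  simp_rw [← hζ]
  funext T
  rw [Finset.sum_apply]
  by_cases hT : T.card < n
  · simp only [tr, hcs, if_pos hT, Nat.zero_le, if_true, Nat.sub_zero]
    conv_lhs => rw [← sum_homogeneousComponent (ω T)]
    refine Finset.sum_subset ?_ ?_
    · intro x hx
      simp only [Finset.mem_range] at *
      have : (ω T).totalDegree ≤ Finset.univ.sup (fun T => (ω T).totalDegree) :=
        Finset.le_sup (f := fun T => (ω T).totalDegree) (Finset.mem_univ T)
      omega
    · intro x _ hx
      simp only [Finset.mem_range, not_lt] at hx
      exact homogeneousComponent_eq_zero _ _ (by omega)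
  · simp only [tr, if_neg hT, Finset.sum_const_zero]
    exact hs T (by omega)

theorem main_abs (c c' : Fin n → MvPolynomial (Fin n) K) (g : MvPolynomial (Fin n) K) (N : ℕ)
    (hN : ∀ i, ∃ (l : Fin n → MvPolynomial (Fin n) K) (μ : MvPolynomial (Fin n) K),
      (X i : MvPolynomial (Fin n) K) ^ N = ∑ j, l j * c j + μ * g)
    {e d : ℕ} (hc : ∀ j, (c j).IsHomogeneous e) (hg : g.IsHomogeneous d) (hd : 1 ≤ d) (hn : 2 ≤ n)
    (k : ℕ) (hk : g ^ k ∈ Ideal.span (Set.range c ∪ {u | ∃ Θ : Fin n → MvPolynomial (Fin n) K,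
      ∑ j, Θ j * c j = 0 ∧ u = ∑ j, Θ j * c' j}))
    (ω ω' : Finset (Fin n) → MvPolynomial (Fin n) K)
    (hs : ∀ T, n ≤ T.card → ω T = 0) (h0 : wd c ω = 0) (h1 : wd c ω' + wd c' ω = 0) :
    ∃ ζ, ω = wd c ζ := by
  let A : Ideal (MvPolynomial (Fin n) K) :=
    { carrier := {u | ∃ η, u • ω = wd c η}
      add_mem' := by
        rintro a b ⟨x, hx⟩ ⟨y, hy⟩
        exact ⟨x + y, by rw [add_smul, hx, hy, map_add]⟩
      zero_mem' := ⟨0, by simp⟩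
      smul_mem' := by
        rintro r a ⟨x, hx⟩
        exact ⟨r • x, by rw [smul_eq_mul, mul_smul, hx, map_smul]⟩ }
  have hA : Ideal.span (Set.range c ∪ {u | ∃ Θ : Fin n → MvPolynomial (Fin n) K,
      ∑ j, Θ j * c j = 0 ∧ u = ∑ j, Θ j * c' j}) ≤ A := by
    rw [Ideal.span_le]
    rintro u (⟨i, rfl⟩ | ⟨Θ, hΘ, rfl⟩)
    · refine ⟨ct (Pi.single i 1) ω, ?_⟩
      have := wd_ct_apply c (Pi.single i 1) ω
      rw [h0, map_zero, add_zero] at this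
      rw [this]
      congr 1
      simp [Pi.single_apply]
    · have e1 := wd_ct_apply c Θ ω
      rw [h0, map_zero, add_zero, hΘ, zero_smul] at e1
      obtain ⟨η, hη⟩ := acyc_all c g N hN hc hg hd hn (ct Θ ω) (by
        intro T hT
        rw [ct_apply]
        refine Finset.sum_eq_zero fun j hj => ?_
        rw [hs, mul_zero, mul_zero]
        rw [Finset.card_insert_of_notMem (by simpa using hj)]; omega) e1
      refine ⟨ct Θ ω' - wd c' η, ?_⟩
      have e2 := wd_ct_apply c' Θ ω
      have e3 := wd_ct_apply c Θ ω'
      rw [hΘ, zero_smul] at e3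
      rw [← e2, hη, wd_anti_apply, eq_neg_of_add_eq_zero_right h1, map_neg, map_sub,
        eq_neg_of_add_eq_zero_left e3]
      abel
  have key : ∀ k, g ^ k ∈ A → ∃ ζ, ω = wd c ζ := by
    intro k
    induction k with
    | zero => rintro ⟨η, hη⟩; exact ⟨η, by simpa using hη⟩
    | succ k ih =>
      rintro ⟨η, hη⟩
      apply ih
      obtain ⟨ζ, _, h2, _⟩ := cone_acyc c g N hN (g ^ k • ω)
        (fun T => if T.card + 1 < n then η T else 0) (by
          intro T hT; simp [hs T hT]) (by
          intro T hT; simp [hT]) (by rw [map_smul, h0, smul_zero]) (by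
          rw [smul_smul, ← pow_succ', hη]
          funext T
          by_cases hT : T.card < n
          · rw [wd_apply, wd_apply]
            refine Finset.sum_congr rfl fun j hj => ?_
            have := Finset.card_pos.mpr ⟨j, hj⟩
            rw [if_pos]
            rw [Finset.card_erase_of_mem hj]; omega
          · rw [← hη, wd_apply, Pi.smul_apply, hs T (by omega), smul_zero]
            symm
            refine Finset.sum_eq_zero fun j hj => ?_
            rw [if_neg, mul_zero, mul_zero]
            rw [Finset.card_erase_of_mem hj]; omega)
      exact ⟨ζ, h2⟩
  exact key k (hA hk)

end Graded


section PartD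

variable {σ : Type*} [Fintype σ] {K : Type*} [Field K]

lemma mem_mm_iff (q : MvPolynomial σ K) : q ∈ idealOfVars σ K ↔ constantCoeff q = 0 := by
  have := mem_pow_idealOfVars_iff' (σ := σ) (R := K) 1 q
  rw [pow_one] at this
  rw [this]
  constructor
  · intro h
    exact h 0 (by simp)
  · intro h x hx
    have : x = 0 := by
      have h0 : x.degree = 0 := by omega
      exact (Finsupp.degree_eq_zero_iff x).mp h0
    rw [this]; exact h

lemma ser_decomp (k : ℕ) (s : MvPowerSeries σ K)
    (hs : ∀ x : σ →₀ ℕ, x.degree < k + 1 → MvPowerSeries.coeff x s = 0) :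
    ∃ t : σ → MvPowerSeries σ K, (∀ i (x : σ →₀ ℕ), x.degree < k → MvPowerSeries.coeff x (t i) = 0) ∧
      s = ∑ i, MvPowerSeries.X i * t i := by
  classical
  have hι : ∀ x : σ →₀ ℕ, ∃ o : Option σ, x ≠ 0 → ∃ i, o = some i ∧ x i ≠ 0 := by
    intro x
    by_cases hx : x = 0
    · exact ⟨none, fun h => absurd hx h⟩
    · obtain ⟨i, hi⟩ := Finsupp.ne_iff.mp hx
      exact ⟨some i, fun _ => ⟨i, rfl, by simpa using hi⟩⟩
  choose ι hι using hι
  let t : σ → MvPowerSeries σ K := fun i x =>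
    if ι (x + Finsupp.single i 1) = some i then MvPowerSeries.coeff (x + Finsupp.single i 1) s else 0
  have ht : ∀ i x, MvPowerSeries.coeff x (t i) =
    if ι (x + Finsupp.single i 1) = some i then MvPowerSeries.coeff (x + Finsupp.single i 1) s else 0 :=
    fun i x => rfl
  refine ⟨t, ?_, ?_⟩
  · intro i x hx
    rw [ht]
    split_ifs
    · apply hs
      rw [map_add]
      simp only [Finsupp.degree_single]
      omega
    · rfl
  · ext x
    rw [map_sum]
    have h1 : ∀ i, MvPowerSeries.coeff x (MvPowerSeries.X i * t i) =
        if Finsupp.single i 1 ≤ x ∧ ι x = some i then MvPowerSeries.coeff x s else 0 := by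
      intro i
      rw [MvPowerSeries.X, MvPowerSeries.coeff_monomial_mul, one_mul]
      by_cases hi : Finsupp.single i 1 ≤ x
      · rw [if_pos hi, ht, tsub_add_cancel_of_le hi]
        simp [hi]
      · simp [hi]
    simp_rw [h1]
    by_cases hx : x = 0
    · subst hx
      rw [hs 0 (by simp)]
      simp
    · obtain ⟨i, hi, hxi⟩ := hι x hx
      rw [Finset.sum_eq_single i]
      · rw [if_pos]
        refine ⟨?_, hi⟩
        rw [Finsupp.single_le_iff]
        omega
      · intro j _ hj
        rw [if_neg]
        rintro ⟨_, h⟩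
        rw [hi] at h
        exact hj (Option.some.inj h).symm
      · simp

lemma ser_pow {B : Type*} [CommRing B] [Algebra K B] (I : Ideal B) (θ : MvPowerSeries σ K →ₐ[K] B)
    (hθ : ∀ i, θ (MvPowerSeries.X i) ∈ I) (k : ℕ) : ∀ s : MvPowerSeries σ K,
    (∀ x : σ →₀ ℕ, x.degree < k → MvPowerSeries.coeff x s = 0) → θ s ∈ I ^ k := by
  induction k with
  | zero => intro s _; simp
  | succ k ih =>
    intro s hs
    obtain ⟨t, ht, rfl⟩ := ser_decomp k s hs
    rw [map_sum]
    refine Ideal.sum_mem _ fun i _ => ?_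
    rw [map_mul, pow_succ']
    exact Ideal.mul_mem_mul (hθ i) (ih _ (ht i))

/-- the ideal `(h) + m^N`. -/
def IN (h : MvPolynomial σ K) (N : ℕ) : Ideal (MvPolynomial σ K) :=
  Ideal.span {h} ⊔ idealOfVars σ K ^ N

lemma exists_qN (h : MvPolynomial σ K) (N : ℕ) :
    ∃ q : (MvPowerSeries σ K ⧸ Ideal.span {(h : MvPowerSeries σ K)}) →ₐ[K] MvPolynomial σ K ⧸ IN h N,
      ∀ s : MvPowerSeries σ K, q (Ideal.Quotient.mk _ s) =
        Ideal.Quotient.mk _ (MvPowerSeries.truncTotal N s) := by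
  have hle : idealOfVars σ K ^ N ≤ IN h N := le_sup_right
  let π : MvPowerSeries σ K →ₐ[K] MvPolynomial σ K ⧸ IN h N :=
    (Ideal.Quotient.factorₐ K hle).comp ((MvPowerSeries.truncTotalAlgHom σ K N).restrictScalars K)
  have hπ : ∀ s, π s = Ideal.Quotient.mk _ (MvPowerSeries.truncTotal N s) := fun s => rfl
  have hh : π (h : MvPowerSeries σ K) = 0 := by
    rw [hπ, Ideal.Quotient.eq_zero_iff_mem]
    have h1 : MvPowerSeries.truncTotal N (h : MvPowerSeries σ K) - h ∈ IN h N := by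
      apply hle
      rw [mem_pow_idealOfVars_iff']
      intro x hx
      rw [coeff_sub, MvPowerSeries.coeff_truncTotal _ hx]
      simp
    have h2 : h ∈ IN h N := Ideal.mem_sup_left (Ideal.mem_span_singleton_self h)
    simpa using add_mem h1 h2
  refine ⟨Ideal.Quotient.liftₐ _ π ?_, ?_⟩
  · intro a ha
    have : Ideal.span {(h : MvPowerSeries σ K)} ≤ RingHom.ker π := by
      rw [Ideal.span_singleton_le_iff_mem]; exact hh
    exact this ha
  · intro s
    rw [← hπ]
    rfl

lemma trunc_coe_sub (h : MvPolynomial σ K) (N : ℕ) (q : MvPolynomial σ K) :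
    MvPowerSeries.truncTotal N (q : MvPowerSeries σ K) - q ∈ IN h N := by
  apply (le_sup_right : idealOfVars σ K ^ N ≤ IN h N)
  rw [mem_pow_idealOfVars_iff']
  intro x hx
  rw [coeff_sub, MvPowerSeries.coeff_truncTotal _ hx]
  simp

lemma IN_le (h : MvPolynomial σ K) (N : ℕ) (hN : 1 ≤ N) (h0 : constantCoeff h = 0) :
    IN h N ≤ idealOfVars σ K := by
  refine sup_le ?_ ?_
  · rw [Ideal.span_singleton_le_iff_mem, mem_mm_iff]; exact h0
  · exact Ideal.pow_le_self (by omega)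

lemma lift_hom (h : MvPolynomial σ K) (N : ℕ) (hN : 1 ≤ N) (h0 : constantCoeff h = 0)
    (Θ : MvPowerSeries σ K →ₐ[K] MvPolynomial σ K ⧸ IN h N) :
    ∃ φ : MvPolynomial σ K →ₐ[K] MvPolynomial σ K, (∀ i, φ (X i) ∈ idealOfVars σ K) ∧
      (∀ q : MvPolynomial σ K, Ideal.Quotient.mk _ (φ q) = Θ q) ∧
      ∀ s, Θ s = Ideal.Quotient.mk _ (φ (MvPowerSeries.truncTotal N s)) := by
  have hs : ∀ i, ∃ t : MvPolynomial σ K, Ideal.Quotient.mk (IN h N) t = Θ (MvPowerSeries.X i) :=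
    fun i => Ideal.Quotient.mk_surjective _
  choose t ht using hs
  have hφ : ∀ q : MvPolynomial σ K, Ideal.Quotient.mk (IN h N) (aeval t q) = Θ q := by
    intro q
    have : (Ideal.Quotient.mkₐ K (IN h N)).comp (aeval t) =
        Θ.comp (MvPolynomial.coeToMvPowerSeries.algHom K) := by
      apply MvPolynomial.algHom_ext
      intro i
      simp [ht, MvPolynomial.coeToMvPowerSeries.algHom_apply]
    have := DFunLike.congr_fun this q
    simpa [MvPolynomial.coeToMvPowerSeries.algHom_apply] using this
  have htm : ∀ i, t i ∈ idealOfVars σ K := by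
    intro i
    rw [mem_mm_iff]
    by_contra hc
    set c := constantCoeff (t i) with hcdef
    have hu : IsUnit (MvPowerSeries.X i - MvPowerSeries.C c : MvPowerSeries σ K) := by
      rw [MvPowerSeries.isUnit_iff_constantCoeff]
      simpa using hc
    have hu2 := hu.map Θ
    have h3 : Θ (MvPowerSeries.X i - MvPowerSeries.C c : MvPowerSeries σ K) =
        Ideal.Quotient.mk _ (t i - C c) := by
      rw [map_sub, map_sub, ht]
      congr 1
      have := Θ.commutes c
      rw [MvPowerSeries.algebraMap_apply] at this
      simp only [Algebra.algebraMap_self, RingHom.id_apply] at this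
      rw [this]
      rfl
    rw [h3] at hu2
    obtain ⟨b, hb⟩ := hu2.exists_right_inv
    obtain ⟨b, rfl⟩ := Ideal.Quotient.mk_surjective b
    rw [← map_mul, ← map_one (Ideal.Quotient.mk (IN h N)), Ideal.Quotient.eq] at hb
    have := IN_le h N hN h0 hb
    rw [mem_mm_iff] at this
    simp [← hcdef] at this
  refine ⟨aeval t, ?_, hφ, ?_⟩
  · intro i; simpa using htm i
  · intro s
    rw [hφ, ← sub_eq_zero, ← map_sub]
    have h4 := ser_pow ((idealOfVars σ K).map (Ideal.Quotient.mk (IN h N))) Θ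
      (fun i => by rw [← ht]; exact Ideal.mem_map_of_mem _ (htm i)) N
      (s - (MvPowerSeries.truncTotal N s : MvPolynomial σ K)) (by
        intro x hx
        rw [map_sub, MvPolynomial.coeff_coe, MvPowerSeries.coeff_truncTotal _ hx, sub_self])
    rw [← Ideal.map_pow] at h4
    have h5 : (idealOfVars σ K ^ N).map (Ideal.Quotient.mk (IN h N)) ≤ ⊥ := by
      rw [Ideal.map_le_iff_le_comap]
      intro x hx
      rw [Ideal.mem_comap, Ideal.mem_bot, Ideal.Quotient.eq_zero_iff_mem]
      exact (le_sup_right : idealOfVars σ K ^ N ≤ IN h N) hx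
    exact h5 h4

lemma hom_mm (φ : MvPolynomial σ K →ₐ[K] MvPolynomial σ K) (hφ : ∀ i, φ (X i) ∈ idealOfVars σ K)
    (k : ℕ) {q : MvPolynomial σ K} (hq : q ∈ idealOfVars σ K ^ k) : φ q ∈ idealOfVars σ K ^ k := by
  have h1 : (idealOfVars σ K).map φ ≤ idealOfVars σ K := by
    rw [Ideal.map_span, Ideal.span_le]
    rintro _ ⟨_, ⟨i, rfl⟩, rfl⟩
    exact hφ i
  have h2 : φ q ∈ (idealOfVars σ K ^ k).map φ := Ideal.mem_map_of_mem _ hq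
  rw [Ideal.map_pow] at h2
  exact Ideal.pow_right_mono h1 k h2

lemma exists_phi_psi (g h : MvPolynomial σ K) (h0 : constantCoeff h = 0)
    (e : (MvPowerSeries σ K ⧸ Ideal.span {(h : MvPowerSeries σ K)}) ≃ₐ[K]
      MvPowerSeries σ K ⧸ Ideal.span {(g : MvPowerSeries σ K)}) (N : ℕ) (hN : 1 ≤ N) :
    ∃ φ ψ : MvPolynomial σ K →ₐ[K] MvPolynomial σ K, (∀ i, φ (X i) ∈ idealOfVars σ K) ∧
      (∀ i, ψ (X i) ∈ idealOfVars σ K) ∧ φ g ∈ IN h N ∧ ψ h ∈ IN g N ∧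
      ∀ q, φ (ψ q) - q ∈ IN h N := by
  have g0 : constantCoeff g = 0 := by
    by_contra hc
    have hu : IsUnit (g : MvPowerSeries σ K) := by
      rw [MvPowerSeries.isUnit_iff_constantCoeff]
      exact (isUnit_iff_ne_zero.mpr hc)
    have h1 : (1 : MvPowerSeries σ K ⧸ Ideal.span {(g : MvPowerSeries σ K)}) = 0 := by
      rw [← map_one (Ideal.Quotient.mk _), Ideal.Quotient.eq_zero_iff_mem,
        Ideal.mem_span_singleton]
      exact hu.dvd
    have h2 : (1 : MvPowerSeries σ K ⧸ Ideal.span {(h : MvPowerSeries σ K)}) = 0 := by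
      apply e.injective
      rw [map_one, map_zero, h1]
    rw [← map_one (Ideal.Quotient.mk _), Ideal.Quotient.eq_zero_iff_mem,
        Ideal.mem_span_singleton, ← isUnit_iff_dvd_one, MvPowerSeries.isUnit_iff_constantCoeff] at h2
    exact h2.ne_zero h0
  obtain ⟨qh, hqh⟩ := exists_qN h N
  obtain ⟨qg, hqg⟩ := exists_qN g N
  obtain ⟨φ, hφ1, hφ2, hφ3⟩ := lift_hom h N hN h0
    ((qh.comp e.symm.toAlgHom).comp (Ideal.Quotient.mkₐ K _))
  obtain ⟨ψ, hψ1, hψ2, hψ3⟩ := lift_hom g N hN g0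
    ((qg.comp e.toAlgHom).comp (Ideal.Quotient.mkₐ K _))
  have hφg : φ g ∈ IN h N := by
    rw [← Ideal.Quotient.eq_zero_iff_mem, hφ2]
    have : Ideal.Quotient.mk (Ideal.span {(g : MvPowerSeries σ K)}) (g : MvPowerSeries σ K) = 0 := by
      rw [Ideal.Quotient.eq_zero_iff_mem]; exact Ideal.mem_span_singleton_self _
    simp [this]
  have hψh : ψ h ∈ IN g N := by
    rw [← Ideal.Quotient.eq_zero_iff_mem, hψ2]
    have : Ideal.Quotient.mk (Ideal.span {(h : MvPowerSeries σ K)}) (h : MvPowerSeries σ K) = 0 := by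
      rw [Ideal.Quotient.eq_zero_iff_mem]; exact Ideal.mem_span_singleton_self _
    simp [this]
  have hφI : ∀ q ∈ IN g N, φ q ∈ IN h N := by
    intro q hq
    obtain ⟨a, ha, b, hb, rfl⟩ := Submodule.mem_sup.mp hq
    obtain ⟨c, rfl⟩ := Ideal.mem_span_singleton.mp ha
    rw [map_add, map_mul]
    refine add_mem (Ideal.mul_mem_right _ _ hφg) (Ideal.mem_sup_right (hom_mm φ hφ1 N hb))
  refine ⟨φ, ψ, hφ1, hψ1, hφg, hψh, ?_⟩
  intro q
  have key : ((Ideal.Quotient.mkₐ K (IN h N)).comp (φ.comp ψ)) = Ideal.Quotient.mkₐ K (IN h N) := by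
    apply MvPolynomial.algHom_ext
    intro i
    obtain ⟨t, ht⟩ := Ideal.Quotient.mk_surjective
      (e (Ideal.Quotient.mk _ ((X i : MvPolynomial σ K) : MvPowerSeries σ K)))
    have h1 := hψ2 (X i)
    have h1' : Ideal.Quotient.mk (IN g N) (ψ (X i)) =
        Ideal.Quotient.mk (IN g N) (MvPowerSeries.truncTotal N t) := by
      rw [h1, ← hqg, ht]; rfl
    rw [Ideal.Quotient.eq] at h1'
    have h2 := hφI _ h1'
    rw [map_sub] at h2
    have h3 := hφ3 t
    have h4 : Ideal.Quotient.mk (IN h N) (φ (MvPowerSeries.truncTotal N t)) =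
        Ideal.Quotient.mk (IN h N) (X i) := by
      rw [← h3]
      have : e.symm (Ideal.Quotient.mk _ t) = Ideal.Quotient.mk _
          ((X i : MvPolynomial σ K) : MvPowerSeries σ K) := by
        rw [ht]; simp
      change qh (e.symm (Ideal.Quotient.mk _ t)) = _
      rw [this, hqh, Ideal.Quotient.eq]
      exact trunc_coe_sub h N _
    change Ideal.Quotient.mk (IN h N) (φ (ψ (X i))) = Ideal.Quotient.mk (IN h N) (X i)
    rw [← h4, Ideal.Quotient.eq]
    exact h2
  have := DFunLike.congr_fun key q
  change Ideal.Quotient.mk (IN h N) (φ (ψ q)) = Ideal.Quotient.mk (IN h N) q at this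
  rwa [Ideal.Quotient.eq] at this



/-- the weighted Euler derivation. -/
def Eul (α : σ → ℕ) : Derivation K (MvPolynomial σ K) (MvPolynomial σ K) :=
  ∑ i, ((α i : MvPolynomial σ K) * X i) • pderiv i

lemma Eul_apply (α : σ → ℕ) (q : MvPolynomial σ K) :
    Eul α q = ∑ i, (α i : MvPolynomial σ K) * X i * pderiv i q := by
  have h : ∀ s : Finset σ, (∑ i ∈ s, ((α i : MvPolynomial σ K) * X i) • pderiv i :
      Derivation K (MvPolynomial σ K) (MvPolynomial σ K)) q =
      ∑ i ∈ s, (α i : MvPolynomial σ K) * X i * pderiv i q := by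
    classical
    intro s
    induction s using Finset.induction_on with
    | empty => simp
    | insert a s ha ih =>
      rw [Finset.sum_insert ha, Finset.sum_insert ha, Derivation.add_apply, ih,
        Derivation.smul_apply, smul_eq_mul]
  exact h _

lemma Eul_mem (α : σ → ℕ) (q : MvPolynomial σ K) : Eul α q ∈ idealOfVars σ K := by
  rw [Eul_apply]
  refine Ideal.sum_mem _ fun i _ => Ideal.mul_mem_right _ _ (Ideal.mul_mem_left _ _ ?_)
  exact Ideal.subset_span ⟨i, rfl⟩

lemma Eul_mem_pow (α : σ → ℕ) (k : ℕ) : ∀ q ∈ idealOfVars σ K ^ k,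
    Eul α q ∈ idealOfVars σ K ^ k := by
  induction k with
  | zero => simp
  | succ k ih =>
    intro q hq
    rw [pow_succ] at hq ⊢
    refine Submodule.mul_induction_on hq ?_ ?_
    · intro a ha b hb
      rw [Derivation.leibniz, smul_eq_mul, smul_eq_mul, mul_comm b]
      exact add_mem (Ideal.mul_mem_mul ha (Eul_mem α b)) (Ideal.mul_mem_mul (ih a ha) hb)
    · intro a b ha hb
      rw [map_add]; exact add_mem ha hb

lemma chain (α : σ → ℕ) (φ ψ : MvPolynomial σ K →ₐ[K] MvPolynomial σ K) (q : MvPolynomial σ K) :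
    φ (Eul α (ψ q)) = ∑ i, φ (ψ (pderiv i q)) * φ (Eul α (ψ (X i))) := by
  classical
  induction q using MvPolynomial.induction_on with
  | C a =>
    have : ψ (C a) = C a := ψ.commutes a
    rw [this]
    simp [Eul_apply]
  | add p q hp hq =>
    simp only [map_add, hp, hq, add_mul, Finset.sum_add_distrib]
  | mul_X p j hp =>
    simp only [map_mul, Derivation.leibniz, smul_eq_mul, map_add, hp, add_mul,
      Finset.sum_add_distrib, pderiv_X, Finset.mul_sum]
    congr 1
    · rw [Finset.sum_eq_single j]
      · simp
      · intro i _ hi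
        rw [Pi.single_eq_of_ne (Ne.symm hi)]; simp
      · simp
    · exact Finset.sum_congr rfl fun i _ => by ring

/-- `m * ((∂h) + (h))`. -/
def LL (h : MvPolynomial σ K) : Ideal (MvPolynomial σ K) :=
  idealOfVars σ K * (Ideal.span (Set.range fun i => pderiv i h) ⊔ Ideal.span {h})

lemma chi_sq (h : MvPolynomial σ K) (N : ℕ) (χ : MvPolynomial σ K →ₐ[K] MvPolynomial σ K)
    (hχ : ∀ i, χ (X i) ∈ idealOfVars σ K) (hI : ∀ q, χ q - q ∈ IN h N) :
    ∀ q ∈ idealOfVars σ K ^ 2, χ q - q ∈ idealOfVars σ K * IN h N := by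
  intro q hq
  rw [pow_two] at hq
  refine Submodule.mul_induction_on hq ?_ ?_
  · intro a ha b hb
    have h1 := hom_mm χ hχ 1 (q := a) (by simpa using ha)
    rw [pow_one] at h1
    have : χ (a * b) - a * b = χ a * (χ b - b) + b * (χ a - a) := by rw [map_mul]; ring
    rw [this]
    exact add_mem (Ideal.mul_mem_mul h1 (hI _)) (Ideal.mul_mem_mul hb (hI _))
  · intro a b ha hb
    rw [map_add, add_sub_add_comm]; exact add_mem ha hb

lemma mul_IN_le (h : MvPolynomial σ K) (N : ℕ) :
    idealOfVars σ K * IN h N ≤ LL h ⊔ idealOfVars σ K ^ N := by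
  rw [IN, Ideal.mul_sup]
  refine sup_le_sup ?_ Ideal.mul_le_right
  exact Ideal.mul_mono_right le_sup_right

lemma step4 (g h : MvPolynomial σ K) (α : σ → ℕ) (d : ℕ) (hd : (d : K) ≠ 0)
    (hg : IsWeightedHomogeneous α g d) (hh : h ∈ idealOfVars σ K ^ 2) (N : ℕ)
    (φ ψ : MvPolynomial σ K →ₐ[K] MvPolynomial σ K) (hφ : ∀ i, φ (X i) ∈ idealOfVars σ K)
    (hψ : ∀ i, ψ (X i) ∈ idealOfVars σ K) (hφg : φ g ∈ IN h N) (hψh : ψ h ∈ IN g N)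
    (hI : ∀ q, φ (ψ q) - q ∈ IN h N) : h ∈ LL h ⊔ idealOfVars σ K ^ N := by
  have hφm : ∀ q ∈ idealOfVars σ K, φ q ∈ idealOfVars σ K := fun q hq => by
    have := hom_mm φ hφ 1 (q := q) (by simpa using hq)
    simpa using this
  have hχ := chi_sq h N (φ.comp ψ) (fun i => hφm _ (hψ i)) hI h hh
  have hχ2 := mul_IN_le h N hχ
  have hE : Eul α g = (d : MvPolynomial σ K) * g := by
    rw [Eul_apply]
    have := hg.sum_weight_X_mul_pderiv
    simp only [nsmul_eq_mul] at this
    rw [← this]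
    exact Finset.sum_congr rfl fun i _ => by ring
  have hL : φ (Eul α (ψ h)) ∈ LL h ⊔ idealOfVars σ K ^ N := by
    rw [chain]
    refine Ideal.sum_mem _ fun i _ => ?_
    have h1 : φ (Eul α (ψ (X i))) ∈ idealOfVars σ K := hφm _ (Eul_mem _ _)
    have h2 : φ (ψ (pderiv i h)) * φ (Eul α (ψ (X i))) =
        φ (Eul α (ψ (X i))) * (φ (ψ (pderiv i h)) - pderiv i h) +
        φ (Eul α (ψ (X i))) * pderiv i h := by ring
    rw [h2]
    refine add_mem (mul_IN_le h N (Ideal.mul_mem_mul h1 (hI _))) (Ideal.mem_sup_left ?_)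
    exact Ideal.mul_mem_mul h1 (Ideal.mem_sup_left (Ideal.subset_span ⟨i, rfl⟩))
  obtain ⟨a, ha, r, hr, har⟩ := Submodule.mem_sup.mp hψh
  obtain ⟨v, rfl⟩ := Ideal.mem_span_singleton.mp ha
  have h3 : φ (Eul α (ψ h)) = φ (Eul α v) * φ g + φ (Eul α r) - d * φ r + d * φ (ψ h) := by
    rw [← har]
    simp only [map_add, map_mul, Derivation.leibniz, smul_eq_mul, hE, map_natCast]
    ring
  have h4 : (d : MvPolynomial σ K) * φ (ψ h) ∈ LL h ⊔ idealOfVars σ K ^ N := by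
    have h5 : (d : MvPolynomial σ K) * φ (ψ h) = φ (Eul α (ψ h)) -
      (φ (Eul α v) * φ g + (φ (Eul α r) - d * φ r)) := by rw [h3]; ring
    rw [h5]
    refine sub_mem hL (add_mem (mul_IN_le h N (Ideal.mul_mem_mul (hφm _ (Eul_mem _ _)) hφg))
      (Ideal.mem_sup_right (sub_mem ?_ (Ideal.mul_mem_left _ _ ?_))))
    · exact hom_mm φ hφ N (Eul_mem_pow α N r hr)
    · exact hom_mm φ hφ N hr
  have h6 : φ (ψ h) ∈ LL h ⊔ idealOfVars σ K ^ N := by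
    have : φ (ψ h) = C ((d : K)⁻¹) * ((d : MvPolynomial σ K) * φ (ψ h)) := by
      rw [← mul_assoc, ← map_natCast (C : K →+* MvPolynomial σ K) d, ← C_mul, inv_mul_cancel₀ hd,
        C_1, one_mul]
    rw [this]
    exact Ideal.mul_mem_left _ _ h4
  have h8 := sub_mem h6 hχ2
  have h7 : φ (ψ h) - ((φ.comp ψ) h - h) = h := by
    rw [AlgHom.comp_apply, sub_sub_cancel]
  rw [h7] at h8
  exact h8

lemma krull_step {R : Type*} [CommRing R] [IsNoetherianRing R] (I L : Ideal R) (h : R)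
    (H : ∀ N, 1 ≤ N → h ∈ L ⊔ I ^ N) : ∃ r ∈ I, (1 - r) * h ∈ L := by
  have h1 : (Ideal.Quotient.mk L h) ∈ (⨅ i : ℕ, I ^ i • ⊤ : Submodule R (R ⧸ L)) := by
    rw [Submodule.mem_iInf]
    intro N
    rcases Nat.eq_zero_or_pos N with rfl | hN
    · simp
    obtain ⟨a, ha, b, hb, hab⟩ := Submodule.mem_sup.mp (H N hN)
    have : Ideal.Quotient.mk L h = b • (1 : R ⧸ L) := by
      conv_lhs => rw [← hab]
      rw [map_add, Ideal.Quotient.eq_zero_iff_mem.mpr ha, zero_add, Algebra.smul_def, mul_one]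
      rfl
    rw [this]
    exact Submodule.smul_mem_smul hb trivial
  obtain ⟨r, hr⟩ := (Ideal.mem_iInf_smul_pow_eq_bot_iff _ _).mp h1
  refine ⟨r.1, r.2, ?_⟩
  have h2 : Ideal.Quotient.mk L (r.1 * h) = Ideal.Quotient.mk L h := by
    rw [← hr, map_mul, Algebra.smul_def]; rfl
  rw [Ideal.Quotient.eq] at h2
  have h3 : (1 - r.1) * h = -(r.1 * h - h) := by ring
  rw [h3]
  exact neg_mem h2

theorem local_qh (h : MvPolynomial σ K) (h0 : eval 0 h = 0)
    (h1 : ∀ i, eval 0 (pderiv i h) = 0) (d : ℕ) (hd : (d : K) ≠ 0) (hw : WeightedHomogSing h d) :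
    ∃ (w : MvPolynomial σ K) (b : σ → MvPolynomial σ K), eval 0 w ≠ 0 ∧ (∀ i, eval 0 (b i) = 0) ∧
      w * h = ∑ i, b i * pderiv i h := by
  classical
  obtain ⟨g, ⟨α, _, _, hg⟩, ⟨e⟩⟩ := hw
  have h0' : constantCoeff h = 0 := by rw [← h0, eval_zero]
  have hh : h ∈ idealOfVars σ K ^ 2 := by
    rw [mem_pow_idealOfVars_iff']
    intro x hx
    by_cases hx0 : x = 0
    · rw [hx0]; exact h0'
    · obtain ⟨i, hi⟩ := Finsupp.ne_iff.mp hx0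
      have hx1 : x = Finsupp.single i 1 := by
        have hle : Finsupp.single i 1 ≤ x := by
          rw [Finsupp.single_le_iff]
          have : x i ≠ 0 := by simpa using hi
          omega
        have h2 : x = (x - Finsupp.single i 1) + Finsupp.single i 1 := (tsub_add_cancel_of_le hle).symm
        have h3 : (x - Finsupp.single i 1).degree = 0 := by
          have := congrArg Finsupp.degree h2
          rw [map_add, Finsupp.degree_single] at this
          omega
        rw [(Finsupp.degree_eq_zero_iff _).mp h3, zero_add] at h2
        exact h2
      have h3 := h1 i
      have h4 : coeff 0 (pderiv i h) = 0 := by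
        rw [← h3, eval_zero]; rfl
      have h5 := coeff_pderiv (i := i) h 0
      rw [h4] at h5
      rw [hx1]
      simpa using h5.symm
  obtain ⟨r, hr, hrh⟩ := krull_step (idealOfVars σ K) (LL h) h (fun N hN => by
    obtain ⟨φ, ψ, hφ, hψ, hφg, hψh, hI⟩ := exists_phi_psi g h h0' e N hN
    exact step4 g h α d hd hg hh N φ ψ hφ hψ hφg hψh hI)
  rw [LL, Ideal.mul_sup] at hrh
  obtain ⟨u, hu, z, hz, huz⟩ := Submodule.mem_sup.mp hrh
  rw [Ideal.mem_mul_span_singleton] at hz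
  obtain ⟨c, hc, rfl⟩ := hz
  rw [← smul_eq_mul, Submodule.mem_ideal_smul_span_iff_exists_sum] at hu
  obtain ⟨b, hb, rfl⟩ := hu
  have ev : ∀ q ∈ idealOfVars σ K, eval 0 q = 0 := by
    intro q hq
    rw [mem_mm_iff] at hq
    rw [eval_zero]; exact hq
  refine ⟨1 - r - c, fun i => b i, ?_, fun i => ev _ (hb i), ?_⟩
  · rw [map_sub, map_sub, ev r hr, ev c hc]; simp
  · rw [Finsupp.sum_fintype _ _ (by simp)] at huz
    simp only [smul_eq_mul] at huz
    linear_combination -huz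

end PartD


section PartE

variable {n : ℕ} {K : Type*} [Field K]

lemma eval_smul_homog {d : ℕ} {P : MvPolynomial (Fin n) K} (hP : P.IsHomogeneous d) (c : K)
    (v : Fin n → K) : eval (c • v) P = c ^ d * eval v P := by
  rw [eval_eq', eval_eq', Finset.mul_sum]
  refine Finset.sum_congr rfl fun x hx => ?_
  have hdeg : ∑ i, x i = d := by
    have := hP (mem_support_iff.mp hx)
    rw [Finsupp.weight_apply, Finsupp.sum_fintype _ _ (by simp)] at this
    simpa using this
  simp only [Pi.smul_apply, smul_eq_mul, mul_pow, Finset.prod_mul_distrib, Finset.prod_pow_eq_pow_sum,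
    hdeg]
  ring

lemma eval_chart (P : MvPolynomial (Fin n) K) (j : Fin n) (a : Fin n → K)
    (y : {i : Fin n // i ≠ j} → K) :
    eval y (chartPoly P j a) = eval (fun i => if h : i = j then 1 else y ⟨i, h⟩ + a i) P := by
  rw [chartPoly, ← coe_aeval_eq_eval, ← AlgHom.coe_toRingHom, ← RingHom.comp_apply]
  have : (aeval y : MvPolynomial {i : Fin n // i ≠ j} K →ₐ[K] K).comp
      (aeval (fun i : Fin n => if h : i = j then 1 else X ⟨i, h⟩ + C (a i))) =
      aeval (fun i => if h : i = j then 1 else y ⟨i, h⟩ + a i) := by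
    apply MvPolynomial.algHom_ext
    intro i
    simp only [AlgHom.comp_apply, aeval_X]
    split_ifs <;> simp
  exact DFunLike.congr_fun this P

lemma pderiv_chart (P : MvPolynomial (Fin n) K) (j : Fin n) (a : Fin n → K)
    (i : {i : Fin n // i ≠ j}) :
    pderiv i (chartPoly P j a) = chartPoly (pderiv i.1 P) j a := by
  classical
  induction P using MvPolynomial.induction_on with
  | C c => simp [chartPoly]
  | add p q hp hq => simp only [chartPoly, map_add] at *; rw [hp, hq]
  | mul_X p k hp =>
    simp only [chartPoly, map_mul, Derivation.leibniz, smul_eq_mul, map_add, aeval_X] at *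
    rw [hp]
    congr 1
    congr 1
    by_cases hk : k = j
    · subst hk
      simp only [dite_true, pderiv_X]
      rw [Pi.single_eq_of_ne i.2.symm]
      simp
    · rw [dif_neg hk]
      simp only [map_add, pderiv_X, pderiv_C, add_zero]
      by_cases hik : k = i.1
      · have h2 : (⟨k, hk⟩ : {i : Fin n // i ≠ j}) = i := Subtype.ext hik
        rw [h2, hik]; simp
      · have h2 : (⟨k, hk⟩ : {i : Fin n // i ≠ j}) ≠ i := fun h => hik (congrArg Subtype.val h)
        rw [Pi.single_eq_of_ne h2, Pi.single_eq_of_ne hik, map_zero]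

lemma homogenize (j : Fin n) (a : Fin n → K) (q : MvPolynomial {i : Fin n // i ≠ j} K) :
    ∃ D0 : ℕ, ∀ D, D0 ≤ D → ∃ Q : MvPolynomial (Fin n) K, Q.IsHomogeneous D ∧
      ∀ v : Fin n → K, v j = 1 → eval v Q = eval (fun i : {i : Fin n // i ≠ j} => v i.1 - a i.1) q := by
  induction q using MvPolynomial.induction_on with
  | C c =>
    refine ⟨0, fun D _ => ⟨C c * X j ^ D, ?_, fun v hv => by simp [hv]⟩⟩
    simpa using (isHomogeneous_C (Fin n) c).mul (isHomogeneous_X_pow j D)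
  | add p q hp hq =>
    obtain ⟨D1, h1⟩ := hp
    obtain ⟨D2, h2⟩ := hq
    refine ⟨max D1 D2, fun D hD => ?_⟩
    obtain ⟨P, hP, hP'⟩ := h1 D (le_trans (le_max_left _ _) hD)
    obtain ⟨Q, hQ, hQ'⟩ := h2 D (le_trans (le_max_right _ _) hD)
    exact ⟨P + Q, hP.add hQ, fun v hv => by rw [map_add, map_add, hP' v hv, hQ' v hv]⟩
  | mul_X p i hp =>
    obtain ⟨D1, h1⟩ := hp
    refine ⟨D1 + 1, fun D hD => ?_⟩
    obtain ⟨P, hP, hP'⟩ := h1 (D - 1) (by omega)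
    refine ⟨P * (X i.1 - C (a i.1) * X j), ?_, fun v hv => ?_⟩
    · have h2 : (X i.1 - C (a i.1) * X j : MvPolynomial (Fin n) K).IsHomogeneous 1 := by
        refine (isHomogeneous_X _ _).sub ?_
        simpa using (isHomogeneous_C (Fin n) (a i.1)).mul (isHomogeneous_X K j)
      have h3 := hP.mul h2
      rwa [Nat.sub_add_cancel (by omega)] at h3
    · rw [map_mul, map_mul, hP' v hv]
      simp [hv]

lemma homog_eq_zero [Infinite K] {d : ℕ} {P : MvPolynomial (Fin n) K} (hP : P.IsHomogeneous d)
    (j : Fin n) (h : ∀ v : Fin n → K, v j = 1 → eval v P = 0) : P = 0 := by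
  have h1 : X j * P = 0 := by
    apply MvPolynomial.funext
    intro v
    by_cases hv : v j = 0
    · simp [hv]
    · have h2 := h ((v j)⁻¹ • v) (by simp [hv])
      rw [eval_smul_homog hP] at h2
      have h3 : eval v P = 0 := by
        rcases mul_eq_zero.mp h2 with h4 | h4
        · exact absurd h4 (pow_ne_zero _ (inv_ne_zero hv))
        · exact h4
      simp [h3]
  rcases mul_eq_zero.mp h1 with h2 | h2
  · exact absurd h2 (X_ne_zero j)
  · exact h2

lemma key_theta [Infinite K] {δ δ' : ℕ} {F G : MvPolynomial (Fin n) K} (hF : F.IsHomogeneous δ)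
    (hG : G.IsHomogeneous δ') (hδ1 : 1 ≤ δ) (hδ' : (δ' : K) ≠ 0)
    (j : Fin n) (a : Fin n → K) (haj : a j = 1) (hFa : eval a F = 0)
    (hdF : ∀ i, eval a (pderiv i F) = 0) (hGa : eval a G ≠ 0) (d : ℕ) (hd : (d : K) ≠ 0)
    (hw : WeightedHomogSing (chartPoly F j a) d) :
    ∃ Θ : Fin n → MvPolynomial (Fin n) K, ∑ i, Θ i * pderiv i F = 0 ∧
      ∀ c : K, c ≠ 0 → eval (c • a) (∑ i, Θ i * pderiv i G) ≠ 0 := by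
  classical
  have hpt : (fun i => if h : i = j then (1 : K) else
      (0 : {i : Fin n // i ≠ j} → K) ⟨i, h⟩ + a i) = a := by
    funext i
    split_ifs with h
    · rw [h, haj]
    · simp
  obtain ⟨w, b, hw0, hb0, hwb⟩ := local_qh (chartPoly F j a) (by rw [eval_chart, hpt, hFa])
    (fun i => by rw [pderiv_chart, eval_chart, hpt, hdF]) d hd hw
  obtain ⟨Dw, hDw⟩ := homogenize j a w
  have hb := fun i => homogenize j a (b i)
  choose Db hDb using hb
  let D := Dw + ∑ i, Db i
  obtain ⟨W, hWh, hW⟩ := hDw D (Nat.le_add_right _ _)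
  have hB := fun i => hDb i (D + 1) (by
    have : Db i ≤ ∑ i, Db i := Finset.single_le_sum (f := Db) (fun _ _ => Nat.zero_le _) (Finset.mem_univ i)
    omega)
  choose B' hBh hB using hB
  let B : Fin n → MvPolynomial (Fin n) K := fun i => if h : i = j then 0 else B' ⟨i, h⟩
  have hBsub : ∀ i : {i : Fin n // i ≠ j}, B i.1 = B' i := fun i => dif_neg i.2
  have hBj : B j = 0 := dif_pos rfl
  have hBhom : ∀ i, (B i).IsHomogeneous (D + 1) := by
    intro i
    by_cases h : i = j
    · rw [h, hBj]; exact isHomogeneous_zero _ _ _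
    · have := hBsub ⟨i, h⟩
      rw [this]; exact hBh _
  have hid : W * F - ∑ i, B i * pderiv i F = 0 := by
    apply homog_eq_zero (d := D + δ) (j := j)
    · refine (hWh.mul hF).sub (IsHomogeneous.sum _ _ _ fun i _ => ?_)
      have := (hBhom i).mul (hF.pderiv (i := i))
      have e : D + 1 + (δ - 1) = D + δ := by omega
      rwa [e] at this
    · intro v hv
      have hpv : (fun i => if h : i = j then (1 : K) else
          (fun i : {i : Fin n // i ≠ j} => v i.1 - a i.1) ⟨i, h⟩ + a i) = v := by
        funext i
        split_ifs with h
        · rw [h, hv]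
        · simp
      have h1 := congrArg (eval (fun i : {i : Fin n // i ≠ j} => v i.1 - a i.1)) hwb
      rw [map_mul, eval_chart, hpv, ← hW v hv, map_sum] at h1
      rw [map_sub, map_mul, h1, Fintype.sum_eq_add_sum_subtype_ne _ j, hBj, zero_mul, zero_add,
        map_sum, sub_eq_zero]
      refine Finset.sum_congr rfl fun i _ => ?_
      rw [map_mul, map_mul, pderiv_chart, eval_chart, hpv, hBsub, hB i v hv]
  have hpa : (fun i : {i : Fin n // i ≠ j} => a i.1 - a i.1) = 0 := by
    funext i; simp
  have hWa : eval a W ≠ 0 := by rw [hW a haj, hpa]; exact hw0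
  have hBa : ∀ i, eval a (B i) = 0 := by
    intro i
    by_cases h : i = j
    · rw [h, hBj, map_zero]
    · have := hBsub ⟨i, h⟩
      rw [this, hB _ a haj, hpa]; exact hb0 _
  have eF : ∑ i, X i * pderiv i F = (δ : MvPolynomial (Fin n) K) * F := by
    rw [hF.sum_X_mul_pderiv, nsmul_eq_mul]
  have eG : ∑ i, X i * pderiv i G = (δ' : MvPolynomial (Fin n) K) * G := by
    rw [hG.sum_X_mul_pderiv, nsmul_eq_mul]
  refine ⟨fun i => W * X i - (δ : MvPolynomial (Fin n) K) * B i, ?_, ?_⟩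
  · simp only [sub_mul, Finset.sum_sub_distrib, mul_assoc, ← Finset.mul_sum, eF]
    linear_combination (δ : MvPolynomial (Fin n) K) * hid
  · intro c hc
    simp only [sub_mul, Finset.sum_sub_distrib, mul_assoc, ← Finset.mul_sum, eG]
    have h0 : eval (c • a) (∑ i, B i * pderiv i G) = 0 := by
      rw [map_sum]
      exact Finset.sum_eq_zero fun i _ => by
        rw [map_mul, eval_smul_homog (hBhom i), hBa, mul_zero, zero_mul]
    rw [map_sub, map_mul, map_mul, map_mul, h0, mul_zero, sub_zero, map_natCast,
      eval_smul_homog hWh, eval_smul_homog hG]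
    exact mul_ne_zero (mul_ne_zero (pow_ne_zero _ hc) hWa)
      (mul_ne_zero hδ' (mul_ne_zero (pow_ne_zero _ hc) hGa))

lemma nsatz [IsAlgClosed K] (S : Set (MvPolynomial (Fin n) K)) (u : MvPolynomial (Fin n) K)
    (h : ∀ v : Fin n → K, (∀ s ∈ S, eval v s = 0) → eval v u = 0) :
    ∃ k, u ^ k ∈ Ideal.span S := by
  have h1 : u ∈ (Ideal.span S).radical := by
    rw [← vanishingIdeal_zeroLocus_eq_radical (K := K), mem_vanishingIdeal_iff]
    intro v hv
    rw [mem_zeroLocus_iff] at hv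
    have := h v (fun s hs => by
      have := hv s (Ideal.subset_span hs)
      simpa [coe_aeval_eq_eval] using this)
    simpa [coe_aeval_eq_eval] using this
  exact h1

lemma hyp_pack [IsAlgClosed K] {p : ℕ} [CharP K p] {δ δ' : ℕ} {f : MvPolynomial (Fin n) K}
    (hsetup : Setup δ δ' f) (hA : HypA p δ δ' f) (v : Fin n → K) (hv : v ≠ 0)
    (hdF : ∀ i, eval v (pderiv i (homogeneousComponent δ f)) = 0) :
    eval v (homogeneousComponent δ' f) ≠ 0 ∧
    ∃ Θ : Fin n → MvPolynomial (Fin n) K, ∑ i, Θ i * pderiv i (homogeneousComponent δ f) = 0 ∧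
      eval v (∑ i, Θ i * pderiv i (homogeneousComponent δ' f)) ≠ 0 := by
  obtain ⟨_, h2δ, h1δ', hlt, _, _⟩ := hsetup
  obtain ⟨hpδ, hpδ', hA⟩ := hA
  have cast_ne : ∀ k : ℕ, ¬ p ∣ k → (k : K) ≠ 0 := fun k hk h =>
    hk ((CharP.cast_eq_zero_iff K p k).mp h)
  have hF := homogeneousComponent_isHomogeneous δ f
  have hG := homogeneousComponent_isHomogeneous δ' f
  have : Infinite K := IsAlgClosed.instInfinite
  obtain ⟨j, hj⟩ := Function.ne_iff.mp hv
  have hj : v j ≠ 0 := by simpa using hj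
  set a := (v j)⁻¹ • v with ha
  have hva : v = v j • a := by rw [ha, smul_smul, mul_inv_cancel₀ hj, one_smul]
  have haj : a j = 1 := by simp [ha, hj]
  have hdFa : ∀ i, eval a (pderiv i (homogeneousComponent δ f)) = 0 := by
    intro i
    rw [ha, eval_smul_homog hF.pderiv, hdF, mul_zero]
  have hFa : eval a (homogeneousComponent δ f) = 0 := by
    have h1 := congrArg (eval a) hF.sum_X_mul_pderiv
    rw [map_sum, nsmul_eq_mul, map_mul, map_natCast] at h1
    rw [Finset.sum_eq_zero (fun i _ => by rw [map_mul, hdFa, mul_zero])] at h1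
    exact (mul_eq_zero.mp h1.symm).resolve_left (cast_ne _ hpδ)
  obtain ⟨_, ⟨d, hd, hw⟩, hGa⟩ := hA a j haj hFa hdFa
  refine ⟨?_, ?_⟩
  · rw [hva, eval_smul_homog hG]
    exact mul_ne_zero (pow_ne_zero _ hj) hGa
  · obtain ⟨Θ, h1, h2⟩ := key_theta hF hG (by omega) (cast_ne _ hpδ') j a haj hFa hdFa hGa d
      (cast_ne _ hd) hw
    refine ⟨Θ, h1, ?_⟩
    rw [hva]
    exact h2 _ hj

lemma hN_pack [IsAlgClosed K] (F G : MvPolynomial (Fin n) K)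
    (h : ∀ v : Fin n → K, v ≠ 0 → (∀ i, eval v (pderiv i F) = 0) → eval v G ≠ 0) :
    ∃ N, ∀ i : Fin n, ∃ (l : Fin n → MvPolynomial (Fin n) K) (μ : MvPolynomial (Fin n) K),
      X i ^ N = ∑ j, l j * pderiv j F + μ * G := by
  have h1 : ∀ i : Fin n, ∃ k, (X i : MvPolynomial (Fin n) K) ^ k ∈
      Ideal.span (Set.range (fun j => pderiv j F) ∪ {G}) := by
    intro i
    apply nsatz
    intro v hv
    by_cases hv0 : v = 0
    · simp [hv0]
    · exact absurd (hv G (Or.inr rfl)) (h v hv0 fun j => hv _ (Or.inl ⟨j, rfl⟩))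
  choose k hk using h1
  refine ⟨∑ i, k i, fun i => ?_⟩
  have hle : k i ≤ ∑ i, k i :=
    Finset.single_le_sum (f := k) (fun _ _ => Nat.zero_le _) (Finset.mem_univ i)
  have h2 := Ideal.pow_mem_of_pow_mem _ (hk i) hle
  rw [Ideal.span_union] at h2
  obtain ⟨u, hu, z, hz, huz⟩ := Submodule.mem_sup.mp h2
  obtain ⟨l, hl⟩ := Ideal.mem_span_range_iff_exists_fun.mp hu
  obtain ⟨μ, hμ⟩ := Ideal.mem_span_singleton'.mp hz
  exact ⟨l, μ, by rw [hl, hμ, huz]⟩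

end PartE


section PartG

variable {n : ℕ} {K : Type*} [Field K]

lemma wedgeD_eq_wd {m : ℕ} (g : MvPolynomial (Fin n) K) (ω : MForm K n m)
    (Ω : Finset (Fin n) → MvPolynomial (Fin n) K) (h : ∀ S hS, ω S hS = Ω S)
    (T : Finset (Fin n)) (hT : T.card = m + 1) :
    wedgeD g ω T hT = wd (fun j => pderiv j g) Ω T := by
  rw [wd_apply, ← Finset.sum_attach, wedgeD]
  refine Finset.sum_congr rfl fun j _ => ?_
  rw [h, sg]
  ring

/-- extension of a form by zero -/
def extF {m : ℕ} (ω : MForm K n m) : Finset (Fin n) → MvPolynomial (Fin n) K :=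
  fun T => if h : T.card = m then ω T h else 0

lemma extF_eq {m : ℕ} (ω : MForm K n m) (S) (hS : S.card = m) : ω S hS = extF ω S := by
  simp [extF, hS]

lemma wd_extF_off {m : ℕ} (c : Fin n → MvPolynomial (Fin n) K) (ω : MForm K n m)
    (T : Finset (Fin n)) (hT : T.card ≠ m + 1) : wd c (extF ω) T = 0 := by
  rw [wd_apply]
  refine Finset.sum_eq_zero fun j hj => ?_
  have : (T.erase j).card ≠ m := by
    rw [Finset.card_erase_of_mem hj]
    have := Finset.card_pos.mpr ⟨j, hj⟩
    omega
  simp [extF, this]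

end PartG


/-- Theorem (vanishing of `E_{δ-δ'+1}^{r,s}` for `r+s ≠ n`, under Hypothesis (A)).
If a homogeneous `m`-form `ω` (of coefficient degree `l`, `m < n`) and a homogeneous
`m`-form `ω'` (of coefficient degree `l - δ + δ'`) satisfy `df^(δ) ∧ ω = 0` and
`df^(δ) ∧ ω' + df^(δ') ∧ ω = 0`, then there are homogeneous `(m-1)`-forms `ξ` (of
coefficient degree `l - δ + 1`) and `ξ'` (of coefficient degree `l - δ' + 1`) with
`ω = df^(δ) ∧ ξ + df^(δ') ∧ ξ'` and `df^(δ) ∧ ξ' = 0`; for `m = 0` the conclusion is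
that `ω = 0` (there are no nonzero `(-1)`-forms). -/
theorem statement0 {K : Type*} [Field K] [IsAlgClosed K] (p : ℕ) [CharP K p]
    (hp : p.Prime) {n : ℕ} (hn : 2 ≤ n) (f : MvPolynomial (Fin n) K) (δ δ' : ℕ)
    (hsetup : Setup δ δ' f) (hA : HypA p δ δ' f)
    (m : ℕ) (hm : m < n) (l : ℕ) (ω ω' : MForm K n m)
    (hω : ∀ T hT, (ω T hT).IsHomogeneous l)
    (hω' : ∀ T hT, HomogZ (ω' T hT) ((l : ℤ) - δ + δ'))
    (h1 : ∀ T (hT : T.card = m + 1), wedgeD (homogeneousComponent δ f) ω T hT = 0)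
    (h2 : ∀ T (hT : T.card = m + 1),
      wedgeD (homogeneousComponent δ f) ω' T hT
        + wedgeD (homogeneousComponent δ' f) ω T hT = 0) :
    (m = 0 → ∀ T hT, ω T hT = 0) ∧
    (∀ (m' : ℕ) (hmm : m = m' + 1),
      ∃ ξ ξ' : MForm K n m',
        (∀ T hT, HomogZ (ξ T hT) ((l : ℤ) - δ + 1)) ∧
        (∀ T hT, HomogZ (ξ' T hT) ((l : ℤ) - δ' + 1)) ∧
        (∀ T (hT : T.card = m' + 1),
          ω T (by omega) = wedgeD (homogeneousComponent δ f) ξ T hT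
            + wedgeD (homogeneousComponent δ' f) ξ' T hT) ∧
        (∀ T (hT : T.card = m' + 1),
          wedgeD (homogeneousComponent δ f) ξ' T hT = 0)) := by
  obtain ⟨ζ, hζ⟩ : ∃ ζ, extF ω = wd (fun j => pderiv j (homogeneousComponent δ f)) ζ := by
    obtain ⟨N, hN⟩ := hN_pack (homogeneousComponent δ f) (homogeneousComponent δ' f)
      (fun v hv hdF => (hyp_pack (p := p) hsetup hA v hv hdF).1)
    obtain ⟨k, hk⟩ := nsatz (Set.range (fun j => pderiv j (homogeneousComponent δ f)) ∪
      {u | ∃ Θ : Fin n → MvPolynomial (Fin n) K,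
        ∑ j, Θ j * pderiv j (homogeneousComponent δ f) = 0 ∧
          u = ∑ j, Θ j * pderiv j (homogeneousComponent δ' f)}) (homogeneousComponent δ' f) (by
      intro v hv
      by_cases hv0 : v = 0
      · have h3 := eval_smul_homog (homogeneousComponent_isHomogeneous δ' f) 0 v
        rw [zero_smul, zero_pow (by have := hsetup.2.2.1; omega), zero_mul] at h3
        rw [hv0]; exact h3
      · obtain ⟨_, Θ, h3, h4⟩ := hyp_pack (p := p) hsetup hA v hv0
          (fun i => hv _ (Or.inl ⟨i, rfl⟩))
        exact absurd (hv _ (Or.inr ⟨Θ, h3, rfl⟩)) h4)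
    refine main_abs (fun j => pderiv j (homogeneousComponent δ f))
      (fun j => pderiv j (homogeneousComponent δ' f)) (homogeneousComponent δ' f) N hN
      (e := δ - 1) (d := δ')
      (fun j => (homogeneousComponent_isHomogeneous δ f).pderiv)
      (homogeneousComponent_isHomogeneous δ' f) hsetup.2.2.1 hn k hk (extF ω) (extF ω') ?_ ?_ ?_
    · intro T hT
      have : T.card ≠ m := by omega
      simp [extF, this]
    · funext T
      by_cases hT : T.card = m + 1
      · rw [← wedgeD_eq_wd _ ω _ (extF_eq ω) T hT, h1 T hT]; rfl
      · exact wd_extF_off _ ω T hT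
    · funext T
      by_cases hT : T.card = m + 1
      · rw [Pi.add_apply, ← wedgeD_eq_wd _ ω _ (extF_eq ω) T hT,
          ← wedgeD_eq_wd _ ω' _ (extF_eq ω') T hT, h2 T hT]; rfl
      · rw [Pi.add_apply, wd_extF_off _ ω T hT, wd_extF_off _ ω' T hT, add_zero]; rfl
  refine ⟨?_, ?_⟩
  · intro hm0 T hT
    have hT0 : T = ∅ := Finset.card_eq_zero.mp (hT.trans hm0)
    rw [extF_eq ω T hT, hζ, wd_apply, hT0, Finset.sum_empty]
  · intro m' hmm
    subst hmm
    have h2δ := hsetup.2.1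
    have hz : ∀ g : MvPolynomial (Fin n) K, ∀ T (hT : T.card = m' + 1),
        wedgeD g (fun _ _ => 0 : MForm K n m') T hT = 0 := by
      intro g T hT
      simp [wedgeD]
    refine ⟨fun S _ => tr (m' + 1) (0 + (δ - 1)) l ζ S, fun _ _ => 0, ?_, ?_, ?_, ?_⟩
    · intro S hS
      change HomogZ (if S.card < m' + 1 then hcs (0 + (δ - 1)) l (ζ S) else 0) _
      rw [if_pos (by omega)]
      unfold hcs
      by_cases h3 : 0 + (δ - 1) ≤ l
      · rw [if_pos h3]
        right
        exact ⟨l - (0 + (δ - 1)), by omega, homogeneousComponent_isHomogeneous _ _⟩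
      · rw [if_neg h3]
        left; rfl
    · intro S hS; left; rfl
    · intro T hT
      rw [hz, add_zero, wedgeD_eq_wd _ _ (tr (m' + 1) (0 + (δ - 1)) l ζ) (fun _ _ => rfl) T hT,
        wd_tr (fun j => (homogeneousComponent_isHomogeneous δ f).pderiv), ← hζ, tr,
        if_pos (by omega), ← extF_eq ω T hT, hcs_self (hω T hT)]
    · intro T hT; exact hz _ T hT

end
end

section
/- Assume Hypothesis (B). Let 0 ≤ m < n, let ω be a homogeneous polynomial differential m-form over K[x_1,…,x_n] of coefficient degree l, and let ω' be a homogeneous m-form of coefficient degree l − δ + δ', and suppose that df^(δ)∧ω = 0 and df^(δ)∧ω' + df^(δ')∧ω = 0. Then there exist a homogeneous (m−1)-form ξ of coefficient degree l − δ + 1 and a homogeneous (m−1)-form ξ' of coefficient degree l − δ' + 1 such that ω = df^(δ)∧ξ + df^(δ')∧ξ' and df^(δ)∧ξ' = 0. (This expresses the vanishing E^{r,s}_{δ−δ'+1} = 0 for all r + s ≠ n of the spectral sequence attached to the degree filtration on the complex of polynomial differential forms with differential φ_f(ω) = df∧ω.) -/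
open MvPolynomial

noncomputable section

section Koszul
variable {S : Type*} [CommRing S] {n : ℕ}

/-- the sign of `i` relative to `T` -/
def kSgn (S : Type*) [CommRing S] {n : ℕ} (i : Fin n) (T : Finset (Fin n)) : S :=
  (-1) ^ (T.filter (fun k => k < i)).card

lemma kSgn_sq (i : Fin n) (T : Finset (Fin n)) : kSgn S i T * kSgn S i T = 1 := by
  unfold kSgn
  rw [← mul_pow]; simp

lemma kSgn_insert (i j : Fin n) (T : Finset (Fin n)) (h : i ∉ T) :
    kSgn S j (insert i T) = if i < j then - kSgn S j T else kSgn S j T := by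
  unfold kSgn
  rw [Finset.filter_insert]
  split_ifs with hij
  · rw [Finset.card_insert_of_notMem (by simp [h]), pow_succ]; ring
  · rfl

lemma kSgn_erase (i j : Fin n) (T : Finset (Fin n)) (h : i ∈ T) :
    kSgn S j (T.erase i) = if i < j then - kSgn S j T else kSgn S j T := by
  have h2 := kSgn_insert (S := S) i j (T.erase i) (Finset.notMem_erase i T)
  rw [Finset.insert_erase h] at h2
  rw [h2]
  split_ifs <;> simp

/-- exterior multiplication by `dx_i` -/
def kE (i : Fin n) : (Finset (Fin n) → S) →ₗ[S] (Finset (Fin n) → S) where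
  toFun ω T := if i ∈ T then kSgn S i T * ω (T.erase i) else 0
  map_add' a b := by
    funext T
    simp only [Pi.add_apply]
    split_ifs <;> ring
  map_smul' a b := by
    funext T
    simp only [Pi.smul_apply, smul_eq_mul, RingHom.id_apply]
    split_ifs <;> ring

/-- contraction by `∂/∂x_i` -/
def kI (i : Fin n) : (Finset (Fin n) → S) →ₗ[S] (Finset (Fin n) → S) where
  toFun ω T := if i ∈ T then 0 else kSgn S i T * ω (insert i T)
  map_add' a b := by
    funext T
    simp only [Pi.add_apply]
    split_ifs <;> ring
  map_smul' a b := by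
    funext T
    simp only [Pi.smul_apply, smul_eq_mul, RingHom.id_apply]
    split_ifs <;> ring

lemma kE_apply (i : Fin n) (ω : Finset (Fin n) → S) (T) :
    kE i ω T = if i ∈ T then kSgn S i T * ω (T.erase i) else 0 := rfl

lemma kI_apply (i : Fin n) (ω : Finset (Fin n) → S) (T) :
    kI i ω T = if i ∈ T then 0 else kSgn S i T * ω (insert i T) := rfl

lemma kE_kE (i j : Fin n) (ω : Finset (Fin n) → S) :
    kE i (kE j ω) = - kE j (kE i ω) := by
  funext T
  rw [Pi.neg_apply]
  by_cases hij : i = j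
  · subst hij
    simp [kE_apply]
  · simp only [kE_apply, Finset.mem_erase]
    by_cases hi : i ∈ T <;> by_cases hj : j ∈ T <;>
      simp only [hi, hj, hij, Ne.symm hij, ne_eq, not_false_eq_true, and_true, and_false,
        if_true, if_false, neg_zero, mul_zero]
    rw [kSgn_erase i j T hi, kSgn_erase j i T hj, Finset.erase_right_comm]
    rcases lt_or_gt_of_ne hij with h | h
    · simp [h, not_lt.mpr h.le]; ring
    · simp [h, not_lt.mpr h.le]; ring

lemma kE_kI (i j : Fin n) (ω : Finset (Fin n) → S) :
    kE i (kI j ω) + kI j (kE i ω) = if i = j then ω else 0 := by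
  funext T
  rw [Pi.add_apply]
  by_cases hij : i = j
  · subst hij
    simp only [kE_apply, kI_apply, if_true]
    by_cases hi : i ∈ T
    · simp only [hi, if_true, Finset.notMem_erase, if_false, Finset.insert_erase, add_zero]
      rw [kSgn_erase i i T hi]
      simp only [lt_irrefl, if_false]
      rw [← mul_assoc, kSgn_sq, one_mul]
    · simp only [hi, if_true, Finset.mem_insert_self, if_false, Finset.erase_insert hi, zero_add]
      rw [kSgn_insert i i T hi]
      simp only [lt_irrefl, if_false, not_false_eq_true, Finset.erase_insert]
      rw [← mul_assoc, kSgn_sq, one_mul]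
  · simp only [kE_apply, kI_apply, Finset.mem_erase, Finset.mem_insert, hij, if_false,
      Pi.zero_apply]
    by_cases hi : i ∈ T <;> by_cases hj : j ∈ T <;>
      simp only [hi, hj, Ne.symm hij, ne_eq, not_false_eq_true, and_true, and_false, or_true,
        or_false, false_or, hij,
        if_true, if_false, neg_zero, mul_zero, add_zero]
    rw [kSgn_erase i j T hi, kSgn_insert j i T hj, Finset.erase_insert_of_ne (Ne.symm hij)]
    rcases lt_or_gt_of_ne hij with h | h
    · simp [h, not_lt.mpr h.le]; ring
    · simp [h, not_lt.mpr h.le]; ring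

/-- wedge with the 1-form `∑ a_i dx_i` -/
def kD (a : Fin n → S) : (Finset (Fin n) → S) →ₗ[S] (Finset (Fin n) → S) :=
  ∑ i, a i • kE i

/-- contraction with the vector field `∑ c_i ∂_i` -/
def kC (c : Fin n → S) : (Finset (Fin n) → S) →ₗ[S] (Finset (Fin n) → S) :=
  ∑ i, c i • kI i

lemma kD_eq (a : Fin n → S) (ω) : kD a ω = ∑ i, a i • kE i ω := by
  simp [kD, LinearMap.sum_apply]

lemma kC_eq (a : Fin n → S) (ω) : kC a ω = ∑ i, a i • kI i ω := by
  simp [kC, LinearMap.sum_apply]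

lemma kD_kD (a b : Fin n → S) (ω) : kD a (kD b ω) = - kD b (kD a ω) := by
  simp only [kD_eq, map_sum, map_smul, Finset.smul_sum]
  rw [Finset.sum_comm, ← Finset.sum_neg_distrib]
  refine Finset.sum_congr rfl fun i _ => ?_
  rw [← Finset.sum_neg_distrib]
  refine Finset.sum_congr rfl fun j _ => ?_
  rw [kE_kE i j, smul_neg, smul_neg, smul_comm]

lemma kE_self (i : Fin n) (ω : Finset (Fin n) → S) : kE i (kE i ω) = 0 := by
  funext T
  simp [kE_apply]

lemma kD_self (a : Fin n → S) (ω) : kD a (kD a ω) = 0 := by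
  simp only [kD_eq, map_sum, map_smul, Finset.smul_sum]
  rw [← Finset.sum_product']
  refine Finset.sum_involution (fun p _ => (p.2, p.1)) ?_ ?_ ?_ ?_
  · rintro ⟨i, j⟩ _
    simp only
    rw [kE_kE i j, smul_neg, smul_neg, smul_comm]
    simp
  · rintro ⟨i, j⟩ _ h1 h2
    simp only [Prod.mk.injEq] at h2
    obtain ⟨rfl, -⟩ := h2
    simp [kE_self] at h1
  · simp
  · simp

lemma kD_kC (a c : Fin n → S) (ω) :
    kD a (kC c ω) + kC c (kD a ω) = (∑ i, c i * a i) • ω := by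
  simp only [kD_eq, kC_eq, map_sum, map_smul, Finset.smul_sum, Finset.sum_smul]
  rw [Finset.sum_comm (s := Finset.univ) (t := Finset.univ) (f := fun i j => c i • a j • _),
    ← Finset.sum_add_distrib]
  refine Finset.sum_congr rfl fun i _ => ?_
  rw [← Finset.sum_add_distrib]
  have : ∀ j, c j • a i • (kE i) ((kI j) ω) + a i • c j • (kI j) ((kE i) ω)
      = if i = j then (c i * a i) • ω else 0 := by
    intro j
    rw [smul_comm (a i) (c j), ← smul_add, ← smul_add, kE_kI]
    split_ifs with h
    · subst h; rw [smul_smul]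
    · simp
  rw [Finset.sum_congr rfl (fun j _ => this j)]
  simp

/-- forms all of whose coefficients lie in `J` -/
def kN (J : Ideal S) : Submodule S (Finset (Fin n) → S) where
  carrier := {ω | ∀ T, ω T ∈ J}
  add_mem' h1 h2 T := J.add_mem (h1 T) (h2 T)
  zero_mem' T := J.zero_mem
  smul_mem' c _ h T := J.mul_mem_left c (h T)

lemma kD_mem (J : Ideal S) (a : Fin n → S) (ω) (h : ω ∈ kN J) : kD a ω ∈ kN J := by
  rw [kD_eq]
  refine Submodule.sum_mem _ fun i _ => Submodule.smul_mem _ _ fun T => ?_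
  rw [kE_apply]
  split_ifs
  · exact J.mul_mem_left _ (h _)
  · exact J.zero_mem

lemma kC_mem (J : Ideal S) (a : Fin n → S) (ω) (h : ω ∈ kN J) : kC a ω ∈ kN J := by
  rw [kC_eq]
  refine Submodule.sum_mem _ fun i _ => Submodule.smul_mem _ _ fun T => ?_
  rw [kI_apply]
  split_ifs
  · exact J.zero_mem
  · exact J.mul_mem_left _ (h _)

/-- `ω` is concentrated on cardinalities satisfying `q` -/
def kDeg (q : ℕ → Prop) (ω : Finset (Fin n) → S) : Prop := ∀ T, ¬ q T.card → ω T = 0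

lemma kC_deg (q : ℕ → Prop) (c : Fin n → S) (ω) (h : kDeg q ω) :
    kDeg (fun k => q (k + 1)) (kC c ω) := by
  intro T hT
  rw [kC_eq, Finset.sum_apply]
  refine Finset.sum_eq_zero fun i _ => ?_
  rw [Pi.smul_apply, kI_apply]
  split_ifs with hi
  · simp
  · rw [h (insert i T) (by rwa [Finset.card_insert_of_notMem hi])]; simp

/-- Projection to cardinalities satisfying `q`. -/
def kR (q : ℕ → Prop) [DecidablePred q] (ω : Finset (Fin n) → S) : Finset (Fin n) → S :=
  fun T => if q T.card then ω T else 0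

lemma kR_deg (q : ℕ → Prop) [DecidablePred q] (ω : Finset (Fin n) → S) : kDeg q (kR q ω) := by
  intro T hT
  simp [kR, hT]

lemma kR_of_deg (q : ℕ → Prop) [DecidablePred q] (ω : Finset (Fin n) → S) (h : kDeg q ω) :
    kR q ω = ω := by
  funext T
  unfold kR
  split_ifs with hT
  · rfl
  · rw [h T hT]

lemma kD_apply (a : Fin n → S) (ω : Finset (Fin n) → S) (T) :
    kD a ω T = ∑ i, a i * (if i ∈ T then kSgn S i T * ω (T.erase i) else 0) := by
  rw [kD_eq, Finset.sum_apply]; rfl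

lemma kR_kD (q : ℕ → Prop) [DecidablePred q] (a : Fin n → S) (ω : Finset (Fin n) → S) :
    kR q (kD a ω) = kD a (kR (fun k => q (k + 1)) ω) := by
  funext T
  rw [kR, kD_apply, kD_apply]
  have : ∀ i ∈ T, (T.erase i).card + 1 = T.card := fun i hi => Finset.card_erase_add_one hi
  split_ifs with h
  · refine Finset.sum_congr rfl fun i _ => ?_
    split_ifs with hi
    · simp [kR, this i hi, h]
    · rfl
  · symm
    refine Finset.sum_eq_zero fun i _ => ?_
    split_ifs with hi
    · simp [kR, this i hi, h]
    · simp

lemma kR_kD' (m : ℕ) (a : Fin n → S) (ω : Finset (Fin n) → S) :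
    kR (fun k => k = m + 1) (kD a ω) = kD a (kR (fun k => k = m) ω) := by
  rw [kR_kD]
  congr 1
  funext T
  simp [kR]

/-- Koszul vanishing for the sequence `(G, a_1, …, a_n)`, relative to an ideal `J`. -/
def kVan (a : Fin n → S) (G : S) (J : Ideal S) (j : ℕ) : Prop :=
  ∀ α β : Finset (Fin n) → S, kDeg (fun k => k = j) α → kDeg (fun k => k + 1 = j) β →
    kD a α ∈ kN J → G • α - kD a β ∈ kN J →
    ∃ α1 β1, α - kD a α1 ∈ kN J ∧ β - (G • α1 - kD a β1) ∈ kN J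

lemma kN_split (J J' : Ideal S) (x : S) (hJ' : J' = J ⊔ Ideal.span {x})
    (ω : Finset (Fin n) → S) (h : ω ∈ kN J') : ∃ μ, ω - x • μ ∈ kN J := by
  have : ∀ T, ∃ y, ω T - x * y ∈ J := by
    intro T
    have := h T
    rw [hJ', Submodule.mem_sup] at this
    obtain ⟨u, hu, v, hv, huv⟩ := this
    obtain ⟨w, rfl⟩ := Ideal.mem_span_singleton'.mp hv
    exact ⟨w, by rw [← huv]; convert hu using 1; ring⟩
  choose μ hμ using this
  exact ⟨μ, hμ⟩

lemma kVan_step (a : Fin n → S) (G : S) (J J' : Ideal S) (x : S)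
    (hJ' : J' = J ⊔ Ideal.span {x}) (hreg : ∀ c, x * c ∈ J → c ∈ J)
    (c : Fin n → S) (c0 : S) (hx : ∑ i, c i * a i + c0 * G = x) (j : ℕ)
    (ih : ∀ j', j = j' + 1 → kVan a G J' j') : kVan a G J j := by
  have hregN : ∀ ω : Finset (Fin n) → S, x • ω ∈ kN J → ω ∈ kN J :=
    fun ω h T => hreg _ (h T)
  intro α β hα hβ h1 h2
  -- the contraction of (α, β)
  set η1 := kC c α + c0 • β with hη1
  set η2 := - kC c β with hη2
  have e1 : x • α - kD a η1 ∈ kN J := by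
    have : x • α - kD a η1 = kC c (kD a α) + c0 • (G • α - kD a β) := by
      have := kD_kC a c α
      rw [hη1, ← hx, add_smul, ← this, map_add, map_smul, smul_sub, smul_smul]
      abel
    rw [this]
    exact Submodule.add_mem _ (kC_mem _ _ _ h1) (Submodule.smul_mem _ _ h2)
  have e2 : x • β - (G • η1 - kD a η2) ∈ kN J := by
    have : x • β - (G • η1 - kD a η2) = - kC c (G • α - kD a β) := by
      have := kD_kC a c β
      rw [hη1, hη2, ← hx, add_smul, ← this, map_neg, map_sub, map_smul, smul_add, smul_smul,
        mul_comm]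
      abel
    rw [this]
    exact Submodule.neg_mem _ (kC_mem _ _ _ h2)
  have hle : ∀ ω : Finset (Fin n) → S, ω ∈ kN J → ω ∈ kN J' := by
    intro ω h T
    rw [hJ']
    exact Ideal.mem_sup_left (h T)
  have hxm : ∀ ω : Finset (Fin n) → S, x • ω ∈ kN J' := by
    intro ω T
    rw [hJ']
    exact Ideal.mem_sup_right (Ideal.mem_span_singleton.mpr ⟨ω T, rfl⟩)
  have key : ∃ α1 β1, η1 - kD a α1 ∈ kN J' ∧ η2 - (G • α1 - kD a β1) ∈ kN J' := by
    rcases j with _ | j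
    · have z1 : η1 = 0 := by
        have hb : β = 0 := by funext T; exact hβ T (by omega)
        have ha : kC c α = 0 := by
          funext T; exact kC_deg _ c α hα T (by omega)
        rw [hη1, hb, ha]; simp
      have z2 : η2 = 0 := by
        have hb : β = 0 := by funext T; exact hβ T (by omega)
        rw [hη2, hb]; simp
      refine ⟨0, 0, ?_, ?_⟩
      · rw [z1]; simp
      · rw [z2]; simp
    · refine ih j rfl η1 η2 ?_ ?_ ?_ ?_
      · intro T hT
        have h3 := kC_deg _ c α hα T (by omega)
        have h4 := hβ T (by omega)
        simp [hη1, h3, h4]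
      · intro T hT
        have h3 := kC_deg _ c β hβ T (by omega)
        simp [hη2, h3]
      · have := Submodule.sub_mem _ (hxm α) (hle _ e1)
        simpa using this
      · have := Submodule.sub_mem _ (hxm β) (hle _ e2)
        simpa using this
  obtain ⟨ζ1, ζ2, k1, k2⟩ := key
  obtain ⟨μ1, m1⟩ := kN_split J J' x hJ' _ k1
  obtain ⟨μ2, m2⟩ := kN_split J J' x hJ' _ k2
  refine ⟨μ1, μ2, hregN _ ?_, hregN _ ?_⟩
  · have := Submodule.add_mem _ e1 (kD_mem J a _ m1)
    convert this using 1
    simp only [map_sub, map_smul, smul_sub, kD_self]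
    abel
  · have := Submodule.sub_mem _ (Submodule.add_mem _ e2 (Submodule.smul_mem _ G m1))
      (kD_mem J a _ m2)
    convert this using 1
    simp only [map_sub, map_smul, smul_sub, kD_self, smul_comm G x]
    abel
end Koszul

section Poly
variable {K : Type*} [Field K] {n : ℕ}

/-- The monomial ideal generated by the first `k` of the powers `X_i ^ N_i`. -/
def kJ (K : Type*) [Field K] {n : ℕ} (N : Fin n → ℕ) (k : ℕ) : Ideal (MvPolynomial (Fin n) K) :=
  Ideal.span ((fun s => monomial s (1 : K)) '' {s | ∃ i : Fin n, i.val < k ∧ s = Finsupp.single i (N i)})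

lemma kJ_zero (N : Fin n → ℕ) : kJ K N 0 = ⊥ := by
  simp [kJ]

lemma kJ_succ (N : Fin n → ℕ) (k : Fin n) :
    kJ K N (k.val + 1) = kJ K N k.val ⊔ Ideal.span {X k ^ N k} := by
  unfold kJ
  rw [← Ideal.span_union]
  congr 1
  ext g
  simp only [Set.mem_image, Set.mem_setOf_eq, Set.mem_union, Set.mem_singleton_iff]
  constructor
  · rintro ⟨s, ⟨i, hi, rfl⟩, rfl⟩
    rcases Nat.lt_succ_iff_lt_or_eq.mp hi with h | h
    · exact Or.inl ⟨_, ⟨i, h, rfl⟩, rfl⟩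
    · right
      have : i = k := Fin.ext h
      subst this
      rw [X_pow_eq_monomial]
  · rintro (⟨s, ⟨i, hi, rfl⟩, rfl⟩ | rfl)
    · exact ⟨_, ⟨i, by omega, rfl⟩, rfl⟩
    · exact ⟨_, ⟨k, by omega, rfl⟩, by rw [X_pow_eq_monomial]⟩

lemma kJ_reg (N : Fin n → ℕ) (k : Fin n) (c : MvPolynomial (Fin n) K)
    (h : X k ^ N k * c ∈ kJ K N k.val) : c ∈ kJ K N k.val := by
  unfold kJ at h ⊢
  rw [mem_ideal_span_monomial_image] at h ⊢
  intro xi hxi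
  obtain ⟨s, ⟨i, hi, rfl⟩, hs⟩ := h (Finsupp.single k (N k) + xi) (by
    rw [mem_support_iff, X_pow_eq_monomial, coeff_monomial_mul, one_mul]
    exact mem_support_iff.mp hxi)
  refine ⟨_, ⟨i, hi, rfl⟩, ?_⟩
  rw [Finsupp.single_le_iff] at hs ⊢
  have hik : k ≠ i := by rintro rfl; omega
  simpa [Finsupp.single_apply, hik] using hs

lemma kVan_poly (a : Fin n → MvPolynomial (Fin n) K) (G : MvPolynomial (Fin n) K)
    (N : Fin n → ℕ) (hN : ∀ k, ∃ (c : Fin n → MvPolynomial (Fin n) K) (c0 : MvPolynomial (Fin n) K),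
      ∑ i, c i * a i + c0 * G = X k ^ N k) (t : ℕ) :
    ∀ k, k + t = n → ∀ j, j < t → kVan a G (kJ K N k) j := by
  induction t with
  | zero => intro k _ j hj; omega
  | succ t ih =>
    intro k hk j hj
    obtain ⟨c, c0, hc⟩ := hN ⟨k, by omega⟩
    refine kVan_step a G _ (kJ K N (k + 1)) _ (kJ_succ N ⟨k, by omega⟩)
      (fun c h => kJ_reg N ⟨k, by omega⟩ c h) c c0 hc j ?_
    intro j' hj'
    exact ih (k + 1) (by omega) j' (by omega)

/-- Exactness of the Koszul complex on `(G, a_1, …, a_n)` in degrees `< n`. -/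
lemma koszul_exact (a : Fin n → MvPolynomial (Fin n) K) (G : MvPolynomial (Fin n) K)
    (N : Fin n → ℕ) (hN : ∀ k, ∃ (c : Fin n → MvPolynomial (Fin n) K) (c0 : MvPolynomial (Fin n) K),
      ∑ i, c i * a i + c0 * G = X k ^ N k) (j : ℕ) (hj : j < n)
    (α β : Finset (Fin n) → MvPolynomial (Fin n) K)
    (hα : kDeg (fun k => k = j) α) (hβ : kDeg (fun k => k + 1 = j) β)
    (h1 : kD a α = 0) (h2 : G • α = kD a β) :
    ∃ α1 β1, α = kD a α1 ∧ β = G • α1 - kD a β1 := by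
  have hz : ∀ ω : Finset (Fin n) → MvPolynomial (Fin n) K, ω ∈ kN (kJ K N 0) → ω = 0 := by
    intro ω h
    funext T
    have := h T
    rwa [kJ_zero, Ideal.mem_bot] at this
  obtain ⟨α1, β1, e1, e2⟩ := kVan_poly a G N hN n 0 (by omega) j hj α β hα hβ
    (by rw [h1]; exact Submodule.zero_mem _) (by rw [h2, sub_self]; exact Submodule.zero_mem _)
  exact ⟨α1, β1, sub_eq_zero.mp (hz _ e1), sub_eq_zero.mp (hz _ e2)⟩

/-- component of degree `l - e` (zero if `l < e`) -/
def hcm (l e : ℕ) (q : MvPolynomial (Fin n) K) : MvPolynomial (Fin n) K :=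
  if e ≤ l then homogeneousComponent (l - e) q else 0

lemma hcm_zero (l e : ℕ) : hcm l e (0 : MvPolynomial (Fin n) K) = 0 := by
  simp [hcm]

lemma hcm_sum {ι : Type*} (s : Finset ι) (l e : ℕ) (g : ι → MvPolynomial (Fin n) K) :
    hcm l e (∑ i ∈ s, g i) = ∑ i ∈ s, hcm l e (g i) := by
  unfold hcm
  split_ifs <;> simp

lemma hcm_mul (l e d : ℕ) (a q : MvPolynomial (Fin n) K) (ha : a.IsHomogeneous d) :
    hcm l e (a * q) = a * hcm l (e + d) q := by
  have key : ∀ i (r : MvPolynomial (Fin n) K), r.IsHomogeneous i →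
      hcm l e (a * r) = a * hcm l (e + d) r := by
    intro i r hr
    unfold hcm
    rw [homogeneousComponent_of_mem ((mem_homogeneousSubmodule _ _).mpr (ha.mul hr)),
      homogeneousComponent_of_mem ((mem_homogeneousSubmodule _ _).mpr hr)]
    split_ifs <;> first | rfl | omega | simp
  conv_lhs => rw [← sum_homogeneousComponent q]
  conv_rhs => rw [← sum_homogeneousComponent q]
  rw [Finset.mul_sum, hcm_sum, hcm_sum, Finset.mul_sum]
  exact Finset.sum_congr rfl fun i _ => key i _ (homogeneousComponent_isHomogeneous _ _)

lemma hcm_self (l : ℕ) (q : MvPolynomial (Fin n) K) (hq : q.IsHomogeneous l) : hcm l 0 q = q := by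
  simp [hcm, homogeneousComponent_eq_self hq]

lemma hcm_hom (l e : ℕ) (q : MvPolynomial (Fin n) K) :
    (hcm l e q).IsHomogeneous (l - e) := by
  unfold hcm
  split_ifs
  · exact homogeneousComponent_isHomogeneous _ _
  · exact isHomogeneous_zero _ _ _

lemma hcm_homZ (l e : ℕ) (q : MvPolynomial (Fin n) K) :
    HomogZ (hcm l e q) ((l : ℤ) - e) := by
  unfold hcm HomogZ
  split_ifs with h
  · exact Or.inr ⟨l - e, by omega, homogeneousComponent_isHomogeneous _ _⟩
  · exact Or.inl rfl

/-- coefficientwise `hcm` -/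
def kH (l e : ℕ) (ω : Finset (Fin n) → MvPolynomial (Fin n) K) :
    Finset (Fin n) → MvPolynomial (Fin n) K := fun T => hcm l e (ω T)

lemma kSgn_hom (i : Fin n) (T : Finset (Fin n)) :
    (kSgn (MvPolynomial (Fin n) K) i T).IsHomogeneous 0 := by
  unfold kSgn
  have : (-1 : MvPolynomial (Fin n) K) ^ (T.filter (fun k => k < i)).card
      = C ((-1) ^ (T.filter (fun k => k < i)).card) := by simp
  rw [this]
  exact isHomogeneous_C _ _

lemma kH_kD (l e d : ℕ) (a : Fin n → MvPolynomial (Fin n) K) (ha : ∀ i, (a i).IsHomogeneous d)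
    (ω : Finset (Fin n) → MvPolynomial (Fin n) K) :
    kH l e (kD a ω) = kD a (kH l (e + d) ω) := by
  funext T
  rw [kH, kD_apply, kD_apply, hcm_sum]
  refine Finset.sum_congr rfl fun i _ => ?_
  rw [hcm_mul _ _ d _ _ (ha i)]
  split_ifs
  · rw [hcm_mul _ _ 0 _ _ (kSgn_hom i T)]; rfl
  · rw [hcm_zero]

lemma kH_smul (l e d : ℕ) (G : MvPolynomial (Fin n) K) (hG : G.IsHomogeneous d)
    (ω : Finset (Fin n) → MvPolynomial (Fin n) K) :
    kH l e (G • ω) = G • kH l (e + d) ω := by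
  funext T
  exact hcm_mul l e d G _ hG

lemma kH_sub (l e : ℕ) (ω η : Finset (Fin n) → MvPolynomial (Fin n) K) :
    kH l e (ω - η) = kH l e ω - kH l e η := by
  funext T
  simp only [kH, hcm, Pi.sub_apply]
  split_ifs <;> simp

/-- Vanishing of the Koszul cohomology of `(a_1, …, a_n)` in degrees `< n - 1`. -/
lemma koszul_low (a : Fin n → MvPolynomial (Fin n) K) (G : MvPolynomial (Fin n) K)
    (N : Fin n → ℕ) (hN : ∀ k, ∃ (c : Fin n → MvPolynomial (Fin n) K) (c0 : MvPolynomial (Fin n) K),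
      ∑ i, c i * a i + c0 * G = X k ^ N k) (d e : ℕ) (ha : ∀ i, (a i).IsHomogeneous d)
    (hG : G.IsHomogeneous e) (he : 1 ≤ e) (m : ℕ) (hm : m + 1 < n) (l : ℕ) :
    ∀ β : Finset (Fin n) → MvPolynomial (Fin n) K, (∀ T, (β T).IsHomogeneous l) →
      kDeg (fun k => k = m) β → kD a β = 0 → ∃ ξ, β = kD a ξ := by
  induction l using Nat.strong_induction_on with
  | _ l ih =>
  intro β hβ hβm hd
  obtain ⟨α1, β1, e1, e2⟩ := koszul_exact a G N hN (m + 1) hm 0 β (fun T _ => rfl)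
    (fun T hT => hβm T (by omega)) (map_zero _) (by rw [hd, smul_zero])
  set α2 := kR (fun k => k = m) (kH l e α1) with hα2
  have hβ2 : β = G • α2 - kD a (kR (fun k => k + 1 = m) (kH l d β1)) := by
    have h1 : kH l 0 β = β := funext fun T => hcm_self l _ (hβ T)
    have h2 : β = G • kH l e α1 - kD a (kH l d β1) := by
      rw [← h1, e2, kH_sub, kH_smul l 0 e G hG, kH_kD l 0 d a ha, zero_add, zero_add]
    rw [← kR_kD (fun k => k = m), hα2, ← kR_of_deg (fun k => k = m) β hβm]
    conv_lhs => rw [h2]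
    funext T
    simp only [kR, Pi.sub_apply, Pi.smul_apply]
    split_ifs <;> simp
  have hdα : kD a α2 = 0 := by
    have h3 : kD a (kH l e α1) = 0 ∨ ¬ e ≤ l := by
      by_cases h : e ≤ l
      · left
        have : kH (l + d) e (kD a α1) = kD a (kH l e α1) := by
          rw [kH_kD _ _ d a ha]
          congr 1
          funext T
          simp only [kH, hcm]
          rw [if_pos (by omega), if_pos h, show l + d - (e + d) = l - e by omega]
        rw [← this, ← e1]
        funext T
        exact hcm_zero _ _
      · right; exact h
    rcases h3 with h3 | h3
    · have := kR_kD' m a (kH l e α1)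
      rw [hα2, ← this, h3]
      funext T
      simp [kR]
    · have : α2 = 0 := by
        funext T
        simp [hα2, kR, kH, hcm, h3]
      rw [this, map_zero]
  have : ∃ ξ, α2 = kD a ξ := by
    by_cases h : e ≤ l
    · refine ih (l - e) (by omega) α2 ?_ (kR_deg _ _) hdα
      intro T
      rw [hα2, kR]
      split_ifs
      · exact hcm_hom _ _ _
      · exact isHomogeneous_zero _ _ _
    · refine ⟨0, ?_⟩
      funext T
      simp [hα2, kR, kH, hcm, h]
  obtain ⟨ξ, hξ⟩ := this
  refine ⟨G • ξ - kR (fun k => k + 1 = m) (kH l d β1), ?_⟩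
  rw [map_sub, map_smul, ← hξ]
  exact hβ2

/-- extension by zero of an `m`-form -/
def kExt {m : ℕ} (ω : MForm K n m) : Finset (Fin n) → MvPolynomial (Fin n) K :=
  fun T => if h : T.card = m then ω T h else 0

lemma kExt_deg {m : ℕ} (ω : MForm K n m) : kDeg (fun k => k = m) (kExt ω) := by
  intro T hT
  simp only [kExt]
  rw [dif_neg hT]

lemma wedgeD_eq {m : ℕ} (g : MvPolynomial (Fin n) K) (ω : MForm K n m)
    (Ω : Finset (Fin n) → MvPolynomial (Fin n) K) (hΩ : ∀ T h, Ω T = ω T h) (T)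
    (hT : T.card = m + 1) :
    wedgeD g ω T hT = kD (fun i => pderiv i g) Ω T := by
  rw [kD_apply, wedgeD]
  simp only [mul_ite, mul_zero]
  rw [← Finset.sum_filter, Finset.filter_mem_eq_inter, Finset.univ_inter, ← Finset.sum_attach T]
  refine Finset.sum_congr rfl fun j _ => ?_
  rw [hΩ (T.erase j.1) (by rw [Finset.card_erase_of_mem j.2]; omega), kSgn]
  ring

lemma kExt_wedge {m : ℕ} (g : MvPolynomial (Fin n) K) (ω : MForm K n m) :
    kD (fun i => pderiv i g) (kExt ω) = kExt (wedgeD g ω) := by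
  funext T
  by_cases hT : T.card = m + 1
  · rw [kExt, dif_pos hT, wedgeD_eq g ω (kExt ω)]
    intro T h
    rw [kExt, dif_pos h]
  · have := kR_kD' m (fun i => pderiv i g) (kExt ω)
    rw [kR_of_deg _ _ (kExt_deg ω)] at this
    rw [← this]
    simp [kR, kExt, hT]

lemma nullst [IsAlgClosed K] (a : Fin n → MvPolynomial (Fin n) K) (G : MvPolynomial (Fin n) K)
    (h : ∀ v : Fin n → K, v ≠ 0 → (∀ i, eval v (a i) = 0) → eval v G ≠ 0) (k : Fin n) :
    ∃ N : ℕ, ∃ (c : Fin n → MvPolynomial (Fin n) K) (c0 : MvPolynomial (Fin n) K),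
      ∑ i, c i * a i + c0 * G = X k ^ N := by
  have hr : X k ∈ (Ideal.span (Set.range a) ⊔ Ideal.span {G}).radical := by
    rw [← vanishingIdeal_zeroLocus_eq_radical (K := K), mem_vanishingIdeal_iff]
    intro v hv
    rw [mem_zeroLocus_iff] at hv
    by_contra hne
    refine h v ?_ ?_ ?_
    · rintro rfl; simp at hne
    · intro i
      have := hv (a i) (Ideal.mem_sup_left (Ideal.subset_span ⟨i, rfl⟩))
      simpa [aeval_eq_eval] using this
    · have := hv G (Ideal.mem_sup_right (Ideal.subset_span rfl))
      simpa [aeval_eq_eval] using this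
  obtain ⟨N, hN⟩ := hr
  obtain ⟨u, hu, v, hv, huv⟩ := Submodule.mem_sup.mp hN
  obtain ⟨c, rfl⟩ := (Ideal.mem_span_range_iff_exists_fun).mp hu
  obtain ⟨w, rfl⟩ := Ideal.mem_span_singleton'.mp hv
  exact ⟨N, c, w, huv⟩

lemma kC_X_hom (l : ℕ) (ω : Finset (Fin n) → MvPolynomial (Fin n) K)
    (h : ∀ T, (ω T).IsHomogeneous l) (T) :
    (kC (fun i => (X i : MvPolynomial (Fin n) K)) ω T).IsHomogeneous (l + 1) := by
  rw [kC_eq, Finset.sum_apply]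
  refine IsHomogeneous.sum _ _ _ fun i _ => ?_
  rw [Pi.smul_apply, kI_apply, smul_eq_mul, add_comm]
  refine (isHomogeneous_X _ _).mul ?_
  split_ifs
  · exact isHomogeneous_zero _ _ _
  · simpa using (kSgn_hom i T).mul (h (insert i T))

/-- The main step: `ω` is exact. -/
lemma main_exact [IsAlgClosed K] (p : ℕ) [CharP K p] (δ δ' : ℕ) (hn : 2 ≤ n)
    (F G : MvPolynomial (Fin n) K) (hF : F.IsHomogeneous δ) (hG : G.IsHomogeneous δ')
    (hδ' : 1 ≤ δ') (hp : p ∣ δ) (hp' : ¬ p ∣ δ')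
    (h : ∀ v : Fin n → K, v ≠ 0 → (∀ i, eval v (pderiv i F) = 0) → eval v G ≠ 0)
    (m : ℕ) (hm : m < n) (l : ℕ) (ω ω' : Finset (Fin n) → MvPolynomial (Fin n) K)
    (hω : ∀ T, (ω T).IsHomogeneous l) (hωm : kDeg (fun k => k = m) ω)
    (h1 : kD (fun i => pderiv i F) ω = 0)
    (h2 : kD (fun i => pderiv i F) ω' + kD (fun i => pderiv i G) ω = 0) :
    ∃ ξ, ω = kD (fun i => pderiv i F) ξ := by
  choose N hN using nullst _ G h
  have hFi : ∀ i, (pderiv i F).IsHomogeneous (δ - 1) := fun i => hF.pderiv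
  by_cases hmn : m + 1 < n
  · exact koszul_low _ G N hN (δ - 1) δ' hFi hG hδ' m hmn l ω hω hωm h1
  obtain ⟨m, rfl⟩ : ∃ m', m = m' + 1 := ⟨m - 1, by omega⟩
  set a : Fin n → MvPolynomial (Fin n) K := fun i => pderiv i F with ha
  set b : Fin n → MvPolynomial (Fin n) K := fun i => pderiv i G with hb
  set x : Fin n → MvPolynomial (Fin n) K := fun i => X i with hx
  have eF : ∀ η, kD a (kC x η) + kC x (kD a η) = 0 := by
    intro η
    have := kD_kC a x η
    rw [this, hx, ha, hF.sum_X_mul_pderiv, nsmul_eq_mul]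
    have : (δ : MvPolynomial (Fin n) K) = 0 := by
      rw [← map_natCast (C : K →+* MvPolynomial (Fin n) K), (CharP.cast_eq_zero_iff K p δ).mpr hp,
        map_zero]
    rw [this, zero_mul, zero_smul]
  have eG : ∀ η, kD b (kC x η) + kC x (kD b η) = (C (δ' : K) * G) • η := by
    intro η
    have := kD_kC b x η
    rw [this, hx, hb, hG.sum_X_mul_pderiv, nsmul_eq_mul]
    simp
  obtain ⟨η, hη⟩ := koszul_low a G N hN (δ - 1) δ' hFi hG hδ' m (by omega) (l + 1) (kC x ω)
    (kC_X_hom l ω hω) (fun T hT => kC_deg _ x ω hωm T (by omega)) (by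
      have := eF ω
      rwa [h1, map_zero, add_zero] at this)
  have hc : (δ' : K) ≠ 0 := fun h => hp' ((CharP.cast_eq_zero_iff K p δ').mp h)
  have e3 : (C (δ' : K) * G) • ω = kD a (kC x ω' - kD b η) := by
    rw [← eG ω, hη, kD_kD, map_sub]
    have h4 : kD b ω = - kD a ω' := by
      rw [eq_neg_iff_add_eq_zero, add_comm]; exact h2
    rw [h4, map_neg]
    have h5 := eF ω'
    rw [add_eq_zero_iff_eq_neg] at h5
    rw [h5]; abel
  have e4 : G • ω = kD a ((C (δ' : K)⁻¹ : MvPolynomial (Fin n) K) • (kC x ω' - kD b η)) := by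
    rw [map_smul, ← e3, smul_smul, ← mul_assoc, ← C_mul, inv_mul_cancel₀ hc, C_1, one_mul]
  have e5 := congrArg (kR (fun k => k = m + 1)) e4
  rw [kR_kD, kR_of_deg _ (G • ω) (fun T hT => by rw [Pi.smul_apply, hωm T hT, smul_zero])] at e5
  obtain ⟨α1, _, e6, _⟩ := koszul_exact a G N hN (m + 1) hm ω _ hωm (kR_deg _ _) h1 e5
  exact ⟨α1, e6⟩
end Poly

/-- Theorem (vanishing of `E_{δ-δ'+1}^{r,s}` for `r+s ≠ n`, under Hypothesis (B)).
If a homogeneous `m`-form `ω` (of coefficient degree `l`, `m < n`) and a homogeneous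
`m`-form `ω'` (of coefficient degree `l - δ + δ'`) satisfy `df^(δ) ∧ ω = 0` and
`df^(δ) ∧ ω' + df^(δ') ∧ ω = 0`, then there are homogeneous `(m-1)`-forms `ξ` (of
coefficient degree `l - δ + 1`) and `ξ'` (of coefficient degree `l - δ' + 1`) with
`ω = df^(δ) ∧ ξ + df^(δ') ∧ ξ'` and `df^(δ) ∧ ξ' = 0`; for `m = 0` the conclusion is
that `ω = 0` (there are no nonzero `(-1)`-forms). -/
theorem statement1 {K : Type*} [Field K] [IsAlgClosed K] (p : ℕ) [CharP K p]
    (hp : p.Prime) {n : ℕ} (hn : 2 ≤ n) (f : MvPolynomial (Fin n) K) (δ δ' : ℕ)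
    (hsetup : Setup δ δ' f) (hB : HypB p δ δ' f)
    (m : ℕ) (hm : m < n) (l : ℕ) (ω ω' : MForm K n m)
    (hω : ∀ T hT, (ω T hT).IsHomogeneous l)
    (hω' : ∀ T hT, HomogZ (ω' T hT) ((l : ℤ) - δ + δ'))
    (h1 : ∀ T (hT : T.card = m + 1), wedgeD (homogeneousComponent δ f) ω T hT = 0)
    (h2 : ∀ T (hT : T.card = m + 1),
      wedgeD (homogeneousComponent δ f) ω' T hT
        + wedgeD (homogeneousComponent δ' f) ω T hT = 0) :
    (m = 0 → ∀ T hT, ω T hT = 0) ∧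
    (∀ (m' : ℕ) (hmm : m = m' + 1),
      ∃ ξ ξ' : MForm K n m',
        (∀ T hT, HomogZ (ξ T hT) ((l : ℤ) - δ + 1)) ∧
        (∀ T hT, HomogZ (ξ' T hT) ((l : ℤ) - δ' + 1)) ∧
        (∀ T (hT : T.card = m' + 1),
          ω T (by omega) = wedgeD (homogeneousComponent δ f) ξ T hT
            + wedgeD (homogeneousComponent δ' f) ξ' T hT) ∧
        (∀ T (hT : T.card = m' + 1),
          wedgeD (homogeneousComponent δ f) ξ' T hT = 0)) := by
  obtain ⟨_, hδ2, hδ1, hlt, _, _⟩ := hsetup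
  obtain ⟨hpd, hpd', _, _, hz⟩ := hB
  set F := homogeneousComponent δ f with hFdef
  set G := homogeneousComponent δ' f with hGdef
  have hF : F.IsHomogeneous δ := homogeneousComponent_isHomogeneous _ _
  have hG : G.IsHomogeneous δ' := homogeneousComponent_isHomogeneous _ _
  have hFi : ∀ i, (pderiv i F).IsHomogeneous (δ - 1) := fun i => hF.pderiv
  have hωh : ∀ T, (kExt ω T).IsHomogeneous l := by
    intro T
    unfold kExt
    split_ifs with h
    · exact hω T h
    · exact isHomogeneous_zero _ _ _
  obtain ⟨ξ0, hξ0⟩ := main_exact p δ δ' hn F G hF hG hδ1 hpd hpd' hz m hm l (kExt ω) (kExt ω')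
    hωh (kExt_deg ω)
    (by
      rw [kExt_wedge]
      funext T
      unfold kExt
      split_ifs with h
      · exact h1 T h
      · rfl)
    (by
      rw [kExt_wedge, kExt_wedge]
      funext T
      rw [Pi.add_apply]
      unfold kExt
      split_ifs with h
      · exact h2 T h
      · simp)
  have hξ1 : kExt ω = kD (fun i => pderiv i F) (kH l (δ - 1) ξ0) := by
    have h3 : kH l 0 (kExt ω) = kExt ω := funext fun T => hcm_self l _ (hωh T)
    have h4 := kH_kD l 0 (δ - 1) (fun i => pderiv i F) hFi ξ0
    rw [← hξ0, h3, zero_add] at h4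
    exact h4
  have hval : ∀ T hT, ω T hT = kD (fun i => pderiv i F) (kH l (δ - 1) ξ0) T := by
    intro T hT
    rw [← hξ1, kExt, dif_pos hT]
  constructor
  · rintro rfl T hT
    rw [hval, Finset.card_eq_zero.mp hT, kD_apply]
    simp
  · rintro m' rfl
    have hzero : ∀ (g : MvPolynomial (Fin n) K) T (hT : T.card = m' + 1),
        wedgeD g (fun _ _ => 0 : MForm K n m') T hT = 0 := by
      intro g T hT
      simp [wedgeD]
    refine ⟨fun T _ => kH l (δ - 1) ξ0 T, fun _ _ => 0, ?_, fun _ _ => Or.inl rfl, ?_, ?_⟩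
    · intro T hT
      have := hcm_homZ l (δ - 1) (ξ0 T)
      rw [show (l : ℤ) - δ + 1 = (l : ℤ) - ((δ - 1 : ℕ) : ℤ) by omega]
      exact this
    · intro T hT
      rw [hzero, add_zero, hval, wedgeD_eq F _ (kH l (δ - 1) ξ0) (fun _ _ => rfl)]
    · intro T hT
      exact hzero _ T hT

end
end
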